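/- arXiv:1006.0466 — 6 statements merged into one kernel-verified Lean document; each statement's English description precedes it below -/
import Mathlib

section
/- Let l be a prime, k an algebraic extension of the finite field F_l, and m a positive integer. Suppose G is a subgroup of GL_2(k) that has no quotient of l-power order, and suppose G has a normal subgroup H which is m-big. Then G is m-big. -/
open Matrix Polynomial

/-- The `h`-equivariant projection from `k²` onto the `α`-eigenspace of a `2 × 2` matrix `A`
for which `α` is a simple root of the characteristic polynomial (the other root then being
`trace A - α`): it is the polynomial `(A - β • 1) / (α - β)` in `A`, where `β = trace A - α`. -/
noncomputable def eigProj {k : Type*} [Field k] (A : Matrix (Fin 2) (Fin 2) k) (α : k) :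
    Matrix (Fin 2) (Fin 2) k :=
  (α - (A.trace - α))⁻¹ • (A - (A.trace - α) • (1 : Matrix (Fin 2) (Fin 2) k))

/-- A subgroup `H` of `GL 2 k` is `m`-big: (i) `H` has no quotient of `l`-power order;
(ii) `H⁰(H, 𝔰𝔩₂(k)) = 0`; (iii) `H¹(H, 𝔰𝔩₂(k)) = 0` (every conjugation 1-cocycle valued in
trace-zero matrices is a coboundary); (iv) for every irreducible `k[H]`-submodule `W` of
`𝔤𝔩₂(k)` there are `h ∈ H` and `α ∈ k` with `α` a simple root of the characteristic
polynomial of `h`, `α^m ≠ β^m` for every other root `β`, and `π_{h,α} ∘ w ∘ i_{h,α} ≠ 0`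
for some `w ∈ W`. -/
def IsMBig (l m : ℕ) {k : Type*} [Field k] (H : Subgroup (GL (Fin 2) k)) : Prop :=
  (∀ N : Subgroup H, N.Normal → ∀ j : ℕ, Nat.card (H ⧸ N) ≠ l ^ (j + 1)) ∧
  (∀ X : Matrix (Fin 2) (Fin 2) k, X.trace = 0 →
    (∀ h : H, (h : GL (Fin 2) k).val * X = X * (h : GL (Fin 2) k).val) → X = 0) ∧
  (∀ c : H → Matrix (Fin 2) (Fin 2) k,
    (∀ g : H, (c g).trace = 0) →
    (∀ g h : H, c (g * h) =
      c g + (g : GL (Fin 2) k).val * c h * ((g : GL (Fin 2) k)⁻¹).val) →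
    ∃ X : Matrix (Fin 2) (Fin 2) k, X.trace = 0 ∧
      ∀ g : H, c g = (g : GL (Fin 2) k).val * X * ((g : GL (Fin 2) k)⁻¹).val - X) ∧
  (∀ W : Submodule k (Matrix (Fin 2) (Fin 2) k),
    (∀ w ∈ W, ∀ h : H, (h : GL (Fin 2) k).val * w * ((h : GL (Fin 2) k)⁻¹).val ∈ W) →
    W ≠ ⊥ →
    (∀ W' : Submodule k (Matrix (Fin 2) (Fin 2) k), W' ≤ W →
      (∀ w ∈ W', ∀ h : H, (h : GL (Fin 2) k).val * w * ((h : GL (Fin 2) k)⁻¹).val ∈ W') →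
      W' = ⊥ ∨ W' = W) →
    ∃ h : H, ∃ α : k,
      (h : GL (Fin 2) k).val.charpoly.rootMultiplicity α = 1 ∧
      (∀ β : k, (h : GL (Fin 2) k).val.charpoly.IsRoot β → β ≠ α → α ^ m ≠ β ^ m) ∧
      ∃ w ∈ W, eigProj (h : GL (Fin 2) k).val α * w * eigProj (h : GL (Fin 2) k).val α ≠ 0)

/-- Snowden–Wiles, White: if a subgroup `G ≤ GL₂(k)` has no quotient of
`l`-power order and has a normal subgroup `H` which is `m`-big, then `G` is `m`-big. -/
theorem isMBig_of_normal_isMBig (l : ℕ) [Fact l.Prime] (k : Type*) [Field k]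
    [Algebra (ZMod l) k] [Algebra.IsAlgebraic (ZMod l) k]
    (m : ℕ) (hm : 0 < m)
    (G H : Subgroup (GL (Fin 2) k))
    (hGq : ∀ N : Subgroup G, N.Normal → ∀ j : ℕ, Nat.card (G ⧸ N) ≠ l ^ (j + 1))
    (hHG : H ≤ G)
    (hnorm : ∀ g ∈ G, ∀ h ∈ H, g * h * g⁻¹ ∈ H)
    (hH : IsMBig l m H) :
    IsMBig l m G := by
  obtain ⟨-, h0, h1, h2⟩ := hH
  refine ⟨hGq, ?_, ?_, ?_⟩
  · intro X hX hc
    exact h0 X hX fun h => hc ⟨h.1, hHG h.2⟩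
  · intro c hct hcc
    obtain ⟨X, hX, hXc⟩ := h1 (fun h => c ⟨h.1, hHG h.2⟩) (fun h => hct _)
      (fun g h => hcc ⟨g.1, hHG g.2⟩ ⟨h.1, hHG h.2⟩)
    refine ⟨X, hX, fun g => ?_⟩
    obtain ⟨d, hd⟩ : ∃ d : G → Matrix (Fin 2) (Fin 2) k, ∀ g, d g =
        c g - ((g : GL (Fin 2) k).val * X * ((g : GL (Fin 2) k)⁻¹).val - X) := ⟨_, fun _ => rfl⟩
    have hdc : ∀ g h : G, d (g * h) =
        d g + (g : GL (Fin 2) k).val * d h * ((g : GL (Fin 2) k)⁻¹).val := by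
      intro g h
      rw [hd, hd, hd, hcc]
      simp only [Subgroup.coe_mul, _root_.mul_inv_rev, Units.val_mul, mul_sub, sub_mul, mul_assoc]
      abel
    have hdH : ∀ h : G, (h : GL (Fin 2) k) ∈ H → d h = 0 := by
      intro h hh
      rw [hd, sub_eq_zero]
      exact hXc ⟨h.1, hh⟩
    have hdt : (d g).trace = 0 := by
      rw [hd, Matrix.trace_sub, Matrix.trace_sub, hct, hX, Matrix.trace_mul_comm, ← mul_assoc,
        ← Units.val_mul]
      simp [hX]
    have hz : d g = 0 := by
      refine h0 _ hdt fun h => ?_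
      have e1 := hdc ⟨h.1, hHG h.2⟩ g
      have e2 := hdc g (g⁻¹ * ⟨h.1, hHG h.2⟩ * g)
      have hm' : ((g⁻¹ * ⟨h.1, hHG h.2⟩ * g : G) : GL (Fin 2) k) ∈ H := by
        have := hnorm (g.1)⁻¹ (G.inv_mem g.2) h.1 h.2
        simpa using this
      have e0 : g * (g⁻¹ * ⟨h.1, hHG h.2⟩ * g) = ⟨h.1, hHG h.2⟩ * g := by group
      rw [hdH _ hm', e0, e1, hdH ⟨h.1, hHG h.2⟩ h.2] at e2
      simp only [zero_add, mul_zero, zero_mul, add_zero] at e2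
      have e3 := congrArg (· * (h : GL (Fin 2) k).val) e2
      simp only [mul_assoc, ← Units.val_mul] at e3
      simpa using e3
    rw [hd, sub_eq_zero] at hz
    exact hz
  · intro W hW hWn _
    obtain ⟨V, ⟨hVW, hV0, hVs⟩, hmin⟩ := (wellFounded_lt
      (α := Submodule k (Matrix (Fin 2) (Fin 2) k))).has_min
      {V | V ≤ W ∧ V ≠ ⊥ ∧
        ∀ w ∈ V, ∀ h : H, (h : GL (Fin 2) k).val * w * ((h : GL (Fin 2) k)⁻¹).val ∈ V}
      ⟨W, le_rfl, hWn, fun w hw h => hW w hw ⟨h.1, hHG h.2⟩⟩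
    obtain ⟨h, α, ha, hb, w, hw, hw'⟩ := h2 V hVs hV0 (fun W' hW' hs => by
      by_cases hb : W' = ⊥
      · exact Or.inl hb
      · refine Or.inr ?_
        by_contra hne
        exact hmin W' ⟨hW'.trans hVW, hb, hs⟩ (lt_of_le_of_ne hW' hne))
    exact ⟨⟨h.1, hHG h.2⟩, α, ha, hb, w, hVW hw, hw'⟩
end

section
/- Let l be a prime, k an algebraic extension of the finite field F_l, m a positive integer, and G a subgroup of GL_2(k). Then G is m-big if and only if the subgroup k^×G of GL_2(k), consisting of all scalar multiples of elements of G by elements of k^×, is m-big. -/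
open Matrix Polynomial

/-- Scalar embedding. -/
def scS (k : Type*) [Field k] : kˣ →* GL (Fin 2) k :=
  Units.map ((Matrix.scalar (Fin 2)).toMonoidHom : k →* Matrix (Fin 2) (Fin 2) k)

lemma scS_val {k : Type*} [Field k] (a : kˣ) :
    (scS k a).val = (a : k) • (1 : Matrix (Fin 2) (Fin 2) k) := by
  rw [Matrix.smul_one_eq_diagonal]; rfl

lemma scS_mul_val {k : Type*} [Field k] (a : kˣ) (g : GL (Fin 2) k) :
    (scS k a * g).val = (a : k) • g.val := by
  rw [Units.val_mul, scS_val]; simp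

lemma scS_comm {k : Type*} [Field k] (a : kˣ) (g : GL (Fin 2) k) :
    scS k a * g = g * scS k a := by
  ext1
  rw [Units.val_mul, Units.val_mul, scS_val]; simp

lemma scS_conj {k : Type*} [Field k] (a : kˣ) (g : GL (Fin 2) k)
    (w : Matrix (Fin 2) (Fin 2) k) :
    (scS k a * g).val * w * ((scS k a * g)⁻¹).val = g.val * w * (g⁻¹).val := by
  have : (scS k a * g)⁻¹ = scS k a⁻¹ * g⁻¹ := by
    rw [_root_.mul_inv_rev, ← map_inv, scS_comm]
  rw [this, scS_mul_val, scS_mul_val]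
  simp [smul_smul]

lemma unit_pow (l : ℕ) [Fact l.Prime] {k : Type*} [Field k]
    [Algebra (ZMod l) k] [Algebra.IsAlgebraic (ZMod l) k] (a : kˣ) :
    ∃ n : ℕ, a ^ n = 1 ∧ (n : k) ≠ 0 := by
  have hint : IsIntegral (ZMod l) (a : k) :=
    (Algebra.IsAlgebraic.isAlgebraic (a : k)).isIntegral
  let F := IntermediateField.adjoin (ZMod l) {(a : k)}
  have : FiniteDimensional (ZMod l) F := IntermediateField.adjoin.finiteDimensional hint
  have : Finite F := Module.finite_of_finite (ZMod l)
  have : Fintype F := Fintype.ofFinite F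
  let x : F := ⟨a, IntermediateField.mem_adjoin_simple_self _ _⟩
  have hx : x ≠ 0 := by
    intro h
    exact a.ne_zero (congrArg Subtype.val h)
  have hpos : 1 ≤ Fintype.card F := Fintype.card_pos
  refine ⟨Fintype.card F - 1, ?_, ?_⟩
  · have := congrArg Subtype.val (FiniteField.pow_card_sub_one_eq_one x hx)
    ext
    simpa using this
  · have h0 : ((Fintype.card F : ℕ) : F) = 0 := FiniteField.cast_card_eq_zero F
    have h1 : ((Fintype.card F : ℕ) : k) = 0 := by
      have := congrArg (algebraMap F k) h0
      rwa [map_natCast, map_zero] at this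
    rw [Nat.cast_sub hpos, h1]
    simp

lemma cocycle_scalar (l : ℕ) [Fact l.Prime] {k : Type*} [Field k]
    [Algebra (ZMod l) k] [Algebra.IsAlgebraic (ZMod l) k]
    (H : Subgroup (GL (Fin 2) k)) (c : H → Matrix (Fin 2) (Fin 2) k)
    (hc : ∀ g h : H, c (g * h) =
      c g + (g : GL (Fin 2) k).val * c h * ((g : GL (Fin 2) k)⁻¹).val)
    (a : kˣ) (z : H) (hz : (z : GL (Fin 2) k) = scS k a) : c z = 0 := by
  have hz1 : ∀ h : H, c (z * h) = c z + c h := by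
    intro h
    rw [hc, hz]
    have := scS_conj a 1 (c h)
    simp only [mul_one] at this
    rw [this]; simp
  have h1 : c 1 = 0 := by
    have := hc 1 1
    simpa using this
  have hn : ∀ n : ℕ, c (z ^ n) = (n : k) • c z := by
    intro n
    induction n with
    | zero => simpa using h1
    | succ n ih => rw [pow_succ', hz1, ih]; push_cast; rw [add_smul, one_smul, add_comm]
  obtain ⟨n, h2, h3⟩ := unit_pow l a
  have h4 : z ^ n = 1 := by
    ext1
    simp [hz, ← map_pow, h2]
  have := hn n
  rw [h4, h1] at this
  exact (smul_eq_zero.mp this.symm).resolve_left h3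

lemma cocycle_scalar_mul (l : ℕ) [Fact l.Prime] {k : Type*} [Field k]
    [Algebra (ZMod l) k] [Algebra.IsAlgebraic (ZMod l) k]
    (H : Subgroup (GL (Fin 2) k)) (c : H → Matrix (Fin 2) (Fin 2) k)
    (hc : ∀ g h : H, c (g * h) =
      c g + (g : GL (Fin 2) k).val * c h * ((g : GL (Fin 2) k)⁻¹).val)
    (a : kˣ) (x g : H) (hx : (x : GL (Fin 2) k) = scS k a * g) : c x = c g := by
  have hz : ((x * g⁻¹ : H) : GL (Fin 2) k) = scS k a := by
    simp [hx]
  have h := hc (x * g⁻¹) g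
  rw [cocycle_scalar l H c hc a _ hz, hz] at h
  have := scS_conj a 1 (c g)
  simp only [mul_one] at this
  rw [this] at h
  simpa using h

lemma quot_scalar (l : ℕ) [Fact l.Prime] {k : Type*} [Field k]
    [Algebra (ZMod l) k] [Algebra.IsAlgebraic (ZMod l) k]
    (H : Subgroup (GL (Fin 2) k)) (N : Subgroup H) [N.Normal] (j : ℕ)
    (hj : Nat.card (H ⧸ N) = l ^ (j + 1))
    (a : kˣ) (x g : H) (hx : (x : GL (Fin 2) k) = scS k a * g) :
    (x : H ⧸ N) = (g : H ⧸ N) := by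
  have hz : ((x * g⁻¹ : H) : GL (Fin 2) k) = scS k a := by
    simp [hx]
  obtain ⟨n, h2, h3⟩ := unit_pow l a
  have h4 : (x * g⁻¹) ^ n = 1 := by
    ext1
    rw [Subgroup.coe_pow, hz, ← map_pow, h2]; simp
  have : CharP k l := charP_of_injective_algebraMap (algebraMap (ZMod l) k).injective l
  have h5 : ¬ l ∣ n := fun h => h3 ((CharP.cast_eq_zero_iff k l n).mpr h)
  have hcop : Nat.Coprime n (l ^ (j + 1)) :=
    Nat.Coprime.pow_right _ (((Fact.out : l.Prime).coprime_iff_not_dvd.mpr h5).symm)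
  have h6 : ((x * g⁻¹ : H) : H ⧸ N) ^ n = 1 := by
    rw [← QuotientGroup.mk_pow, h4]; rfl
  have h7 : ((x * g⁻¹ : H) : H ⧸ N) ^ (l ^ (j + 1)) = 1 := by
    rw [← hj]; exact pow_card_eq_one'
  have h8 : ((x * g⁻¹ : H) : H ⧸ N) = 1 := by
    rw [← orderOf_eq_one_iff]
    exact Nat.eq_one_of_dvd_coprimes hcop (orderOf_dvd_of_pow_eq_one h6)
      (orderOf_dvd_of_pow_eq_one h7)
  rw [QuotientGroup.mk_mul, QuotientGroup.mk_inv] at h8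
  exact mul_inv_eq_one.mp h8

lemma charpoly_isRoot_iff {k : Type*} [Field k] (A : Matrix (Fin 2) (Fin 2) k) (α : k) :
    A.charpoly.IsRoot α ↔ α ^ 2 - A.trace * α + A.det = 0 := by
  rw [Matrix.charpoly_fin_two]; simp

lemma charpoly_simple_iff {k : Type*} [Field k] (A : Matrix (Fin 2) (Fin 2) k) (α : k) :
    A.charpoly.rootMultiplicity α = 1 ↔
      (α ^ 2 - A.trace * α + A.det = 0 ∧ 2 * α - A.trace ≠ 0) := by
  have h0 : A.charpoly ≠ 0 := (Matrix.charpoly_monic A).ne_zero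
  have h1 := Polynomial.one_lt_rootMultiplicity_iff_isRoot (t := α) h0
  have h2 := Polynomial.rootMultiplicity_pos h0 (x := α)
  have h3 : A.charpoly.derivative.IsRoot α ↔ 2 * α - A.trace = 0 := by
    rw [Matrix.charpoly_fin_two]; simp [one_add_one_eq_two]
  rw [h3] at h1
  rw [charpoly_isRoot_iff] at h1 h2
  constructor
  · intro h
    rw [h] at h1 h2
    have := h2.mp one_pos
    exact ⟨this, fun h' => lt_irrefl _ (h1.mpr ⟨this, h'⟩)⟩
  · rintro ⟨ha, hb⟩
    have := h2.mpr ha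
    have h4 : ¬ 1 < A.charpoly.rootMultiplicity α := fun h => hb (h1.mp h).2
    omega

lemma charpoly_isRoot_smul {k : Type*} [Field k] (A : Matrix (Fin 2) (Fin 2) k) (α a : k)
    (ha : a ≠ 0) : (a • A).charpoly.IsRoot (a * α) ↔ A.charpoly.IsRoot α := by
  rw [charpoly_isRoot_iff, charpoly_isRoot_iff, Matrix.trace_smul, Matrix.det_smul]
  have : (a * α) ^ 2 - a • A.trace * (a * α) + a ^ Fintype.card (Fin 2) * A.det
    = a ^ 2 * (α ^ 2 - A.trace * α + A.det) := by
    simp; ring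
  rw [this]; simp [ha]

lemma charpoly_simple_smul {k : Type*} [Field k] (A : Matrix (Fin 2) (Fin 2) k) (α a : k)
    (ha : a ≠ 0) : (a • A).charpoly.rootMultiplicity (a * α) = 1 ↔
      A.charpoly.rootMultiplicity α = 1 := by
  rw [charpoly_simple_iff, charpoly_simple_iff, ← charpoly_isRoot_iff, ← charpoly_isRoot_iff,
    charpoly_isRoot_smul A α a ha, Matrix.trace_smul]
  have : 2 * (a * α) - a • A.trace = a * (2 * α - A.trace) := by simp; ring
  rw [this]; simp [ha]

lemma eigProj_smul {k : Type*} [Field k] (A : Matrix (Fin 2) (Fin 2) k) (α a : k)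
    (ha : a ≠ 0) : eigProj (a • A) (a * α) = eigProj A α := by
  unfold eigProj
  rw [Matrix.trace_smul]
  have h1 : a * α - (a • A.trace - a * α) = a * (α - (A.trace - α)) := by simp; ring
  have h2 : a • A - (a • A.trace - a * α) • (1 : Matrix (Fin 2) (Fin 2) k)
    = a • (A - (A.trace - α) • (1 : Matrix (Fin 2) (Fin 2) k)) := by
    rw [smul_sub, smul_smul]; congr 2; simp; ring
  rw [h1, h2, smul_smul, mul_inv, mul_right_comm, inv_mul_cancel₀ ha, one_mul]

/-- Snowden–Wiles, White: a subgroup `G ≤ GL₂(k)` is `m`-big if and only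
if the subgroup `k^× G` consisting of all products of a scalar matrix (with entry a unit of
`k`) with an element of `G` is `m`-big.  The subgroup `k^× G` is quantified as any subgroup
`K` whose carrier is exactly the set of such products. -/
theorem isMBig_iff_scalarMul_isMBig (l : ℕ) [Fact l.Prime] (k : Type*) [Field k]
    [Algebra (ZMod l) k] [Algebra.IsAlgebraic (ZMod l) k]
    (m : ℕ) (hm : 0 < m)
    (G K : Subgroup (GL (Fin 2) k))
    (hK : (K : Set (GL (Fin 2) k)) =
      {x | ∃ c : kˣ, ∃ g ∈ G,
        x = Units.map ((Matrix.scalar (Fin 2)).toMonoidHom : k →* Matrix (Fin 2) (Fin 2) k) c * g}) :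
    IsMBig l m G ↔ IsMBig l m K := by
  have hmem : ∀ x : GL (Fin 2) k, x ∈ K ↔ ∃ c : kˣ, ∃ g ∈ G, x = scS k c * g := by
    intro x
    rw [← SetLike.mem_coe, hK]; rfl
  have hGK : G ≤ K := fun g hg => (hmem g).mpr ⟨1, g, hg, by simp⟩
  have hex : ∀ x : K, ∃ c : kˣ, ∃ g : G, (x : GL (Fin 2) k) = scS k c * g := by
    intro x
    obtain ⟨c, g, hg, h⟩ := (hmem x).mp x.2
    exact ⟨c, ⟨g, hg⟩, h⟩
  choose s p hsp using hex
  let ι : G →* K := Subgroup.inclusion hGK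
  have hι : ∀ g : G, ((ι g : K) : GL (Fin 2) k) = g := fun g => rfl
  have hpι : ∀ g : G, (g : GL (Fin 2) k) = scS k (s (ι g)) * p (ι g) := fun g => hsp (ι g)
  have hpm : ∀ x y : K, ((p (x * y) : G) : GL (Fin 2) k)
      = scS k ((s (x * y))⁻¹ * (s x * s y)) * ((p x * p y : G) : GL (Fin 2) k) := by
    intro x y
    have h := hsp (x * y)
    rw [Subgroup.coe_mul, hsp x, hsp y] at h
    have h' : (p (x * y) : GL (Fin 2) k) = (scS k (s (x * y)))⁻¹ *
      (scS k (s x) * p x * (scS k (s y) * p y)) := by rw [h]; simp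
    rw [h', map_mul, map_mul, map_inv, Subgroup.coe_mul]
    simp only [mul_assoc]
    rw [← mul_assoc (p x : GL (Fin 2) k) (scS k (s y)), ← scS_comm, mul_assoc]
  have hinv : ∀ W : Submodule k (Matrix (Fin 2) (Fin 2) k),
      (∀ w ∈ W, ∀ h : G, (h : GL (Fin 2) k).val * w * ((h : GL (Fin 2) k)⁻¹).val ∈ W) ↔
      (∀ w ∈ W, ∀ h : K, (h : GL (Fin 2) k).val * w * ((h : GL (Fin 2) k)⁻¹).val ∈ W) := by
    intro W
    constructor
    · intro H w hw h
      rw [hsp h, scS_conj]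
      exact H w hw _
    · intro H w hw h
      exact H w hw (ι h)
  unfold IsMBig
  refine and_congr ?_ (and_congr ?_ (and_congr ?_ ?_))
  · constructor
    · intro H N hN j hj
      let φ : G →* K ⧸ N := (QuotientGroup.mk' N).comp ι
      have hφ : Function.Surjective φ := by
        intro q
        obtain ⟨x, rfl⟩ := QuotientGroup.mk_surjective q
        refine ⟨p x, ?_⟩
        exact (quot_scalar l K N j hj (s x) x (ι (p x)) (hsp x)).symm
      apply H φ.ker inferInstance j
      rw [← hj]
      exact Nat.card_congr (QuotientGroup.quotientKerEquivOfSurjective φ hφ).toEquiv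
    · intro H N hN j hj
      let φ : K →* G ⧸ N := MonoidHom.mk' (fun x => (p x : G ⧸ N)) (by
        intro x y
        exact quot_scalar l G N j hj _ (p (x * y)) (p x * p y) (hpm x y))
      have hφ : Function.Surjective φ := by
        intro q
        obtain ⟨g, rfl⟩ := QuotientGroup.mk_surjective q
        refine ⟨ι g, ?_⟩
        exact (quot_scalar l G N j hj _ g (p (ι g)) (hpι g)).symm
      apply H φ.ker inferInstance j
      rw [← hj]
      exact Nat.card_congr (QuotientGroup.quotientKerEquivOfSurjective φ hφ).toEquiv
  · refine forall_congr' fun X => imp_congr_right fun hX => imp_congr_left ?_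
    constructor
    · intro H h
      rw [hsp h, scS_mul_val, Matrix.smul_mul, Matrix.mul_smul, H]
    · intro H h
      exact H (ι h)
  · constructor
    · intro H c htr hc
      obtain ⟨X, hX, h⟩ := H (fun g => c (ι g)) (fun g => htr _) (fun g h => by
        rw [map_mul, hc]; rfl)
      refine ⟨X, hX, fun x => ?_⟩
      rw [cocycle_scalar_mul l K c hc (s x) x (ι (p x)) (hsp x), h, hsp x, scS_conj]
    · intro H c htr hc
      obtain ⟨X, hX, h⟩ := H (fun x => c (p x)) (fun g => htr _) (fun x y => by
        rw [cocycle_scalar_mul l G c hc _ _ _ (hpm x y), hc]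
        conv_rhs => rw [hsp x, scS_conj])
      refine ⟨X, hX, fun g => ?_⟩
      rw [cocycle_scalar_mul l G c hc _ _ _ (hpι g)]
      exact h (ι g)
  · refine forall_congr' fun W => ?_
    rw [hinv W]
    refine imp_congr_right fun _ => imp_congr_right fun _ => ?_
    have e1 : (∀ W' : Submodule k (Matrix (Fin 2) (Fin 2) k), W' ≤ W →
      (∀ w ∈ W', ∀ h : G, (h : GL (Fin 2) k).val * w * ((h : GL (Fin 2) k)⁻¹).val ∈ W') →
      W' = ⊥ ∨ W' = W) ↔ (∀ W' : Submodule k (Matrix (Fin 2) (Fin 2) k), W' ≤ W →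
      (∀ w ∈ W', ∀ h : K, (h : GL (Fin 2) k).val * w * ((h : GL (Fin 2) k)⁻¹).val ∈ W') →
      W' = ⊥ ∨ W' = W) := by
      refine forall_congr' fun W' => ?_
      rw [hinv W']
    rw [e1]
    refine imp_congr_right fun _ => ?_
    constructor
    · rintro ⟨h, α, H⟩
      exact ⟨ι h, α, H⟩
    · rintro ⟨x, α, h1, h2, w, hw, h3⟩
      have ha : (s x : k) ≠ 0 := (s x).ne_zero
      obtain ⟨γ, rfl⟩ : ∃ γ, α = (s x : k) * γ := ⟨(s x : k)⁻¹ * α, by field_simp⟩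
      rw [hsp x, scS_mul_val] at h1 h2 h3
      rw [eigProj_smul _ _ _ ha] at h3
      refine ⟨p x, γ, (charpoly_simple_smul _ _ _ ha).mp h1, ?_, w, hw, h3⟩
      intro β hβ hne he
      refine h2 (s x * β) ((charpoly_isRoot_smul _ _ _ ha).mpr hβ) ?_ ?_
      · exact fun h => hne (mul_left_cancel₀ ha h)
      · rw [mul_pow, mul_pow, he]
end

section
/- Let l > 3 be a prime and k an algebraic extension of F_l. Let k' be a finite subfield of k of cardinality greater than 5, and suppose H is a subgroup of GL_2(k) satisfying SL_2(k') ⊆ H ⊆ k^×GL_2(k'), where k^×GL_2(k') is the set of scalar multiples (by elements of k^×) of elements of GL_2(k'). Then H is 2-big. -/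
open Matrix Polynomial

section helpers

variable {k : Type*} [Field k]

/-- determinant one matrix as an element of `GL` -/
def slm (a b c d : k) (h : a * d - b * c = 1) : GL (Fin 2) k :=
  ⟨!![a, b; c, d], !![d, -b; -c, a],
    by ext i j; fin_cases i <;> fin_cases j <;> simp [Matrix.mul_apply, Fin.sum_univ_two] <;> first | linear_combination h | ring,
    by ext i j; fin_cases i <;> fin_cases j <;> simp [Matrix.mul_apply, Fin.sum_univ_two] <;> first | linear_combination h | ring⟩

def uu (b : k) : GL (Fin 2) k := slm 1 b 0 1 (by ring)
def ll (b : k) : GL (Fin 2) k := slm 1 0 b 1 (by ring)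
def tt (s : k) (hs : s ≠ 0) : GL (Fin 2) k := slm s 0 0 s⁻¹ (by field_simp; ring)
def ww : GL (Fin 2) k := slm 0 1 (-1) 0 (by ring)

lemma slm_val (a b c d : k) (h) : (slm a b c d h).val = !![a, b; c, d] := rfl
lemma slm_inv (a b c d : k) (h) : ((slm a b c d h)⁻¹).val = !![d, -b; -c, a] := rfl
lemma uu_val (b : k) : (uu b).val = !![1, b; 0, 1] := rfl
lemma uu_inv (b : k) : ((uu b)⁻¹).val = !![1, -b; -0, 1] := rfl
lemma ll_val (b : k) : (ll b).val = !![1, 0; b, 1] := rfl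
lemma ll_inv (b : k) : ((ll b)⁻¹).val = !![1, -0; -b, 1] := rfl
lemma tt_val (s : k) (hs) : (tt s hs).val = !![s, 0; 0, s⁻¹] := rfl
lemma tt_inv (s : k) (hs) : ((tt s hs)⁻¹).val = !![s⁻¹, -0; -0, s] := rfl
lemma ww_val : (ww : GL (Fin 2) k).val = !![0, 1; -1, 0] := rfl
lemma ww_inv : ((ww : GL (Fin 2) k)⁻¹).val = !![0, -1; - -1, 0] := rfl

lemma slm_mul (a b c d a' b' c' d' : k) (h h') : slm a b c d h * slm a' b' c' d' h' =
    slm (a*a'+b*c') (a*b'+b*d') (c*a'+d*c') (c*b'+d*d')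
      (by linear_combination (a*d-b*c)*h' + h) := by
  apply Units.ext
  simp [slm_val]

lemma slm_congr {a b c d a' b' c' d' : k} {h} {h'} (h1 : a = a') (h2 : b = b') (h3 : c = c')
    (h4 : d = d') : slm a b c d h = slm a' b' c' d' h' := by
  subst h1 h2 h3 h4; rfl

lemma gen (k' : Subfield k) (K : Subgroup (GL (Fin 2) k)) (hu : ∀ b ∈ k', uu b ∈ K)
    (hlo : ∀ b ∈ k', ll b ∈ K) (g : GL (Fin 2) k) (hg : ∀ i j, g.val i j ∈ k')
    (hd : g.val.det = 1) : g ∈ K := by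
  have key : ∀ a b c d : k, a ∈ k' → b ∈ k' → c ∈ k' → d ∈ k' → c ≠ 0 → ∀ h, slm a b c d h ∈ K := by
    intro a b c d ha hb hc hd hc0 h
    have : slm a b c d h = uu ((a-1)/c) * ll c * uu ((d-1)/c) := by
      rw [uu, ll, uu, slm_mul, slm_mul]
      apply slm_congr <;> field_simp
      · ring
      · linear_combination -h
      · ring
      · ring
    rw [this]
    exact K.mul_mem (K.mul_mem (hu _ (k'.div_mem (k'.sub_mem ha k'.one_mem) hc)) (hlo _ hc))
      (hu _ (k'.div_mem (k'.sub_mem hd k'.one_mem) hc))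
  have hg' : g.val 0 0 * g.val 1 1 - g.val 0 1 * g.val 1 0 = 1 := by
    rw [← hd, Matrix.det_fin_two]
  have e : g = slm (g.val 0 0) (g.val 0 1) (g.val 1 0) (g.val 1 1) hg' := by
    apply Units.ext
    rw [slm_val]
    ext i j; fin_cases i <;> fin_cases j <;> rfl
  by_cases hc : g.val 1 0 = 0
  · have ha : g.val 0 0 ≠ 0 := by
      intro h0; rw [h0, hc] at hg'; simp at hg'
    have := key (g.val 0 0) (g.val 0 1) (g.val 1 0 + g.val 0 0) (g.val 1 1 + g.val 0 1)
      (hg _ _) (hg _ _) (k'.add_mem (hg _ _) (hg _ _)) (k'.add_mem (hg _ _) (hg _ _))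
      (by rw [hc]; simpa using ha) (by linear_combination hg')
    have h2 : g = (ll 1)⁻¹ * slm (g.val 0 0) (g.val 0 1) (g.val 1 0 + g.val 0 0) (g.val 1 1 + g.val 0 1) (by linear_combination hg') := by
      rw [eq_inv_mul_iff_mul_eq]
      conv_lhs => rw [e]
      rw [ll, slm_mul]
      apply slm_congr <;> ring
    rw [h2]
    exact K.mul_mem (K.inv_mem (hlo _ k'.one_mem)) this
  · rw [e]
    exact key _ _ _ _ (hg _ _) (hg _ _) (hg _ _) (hg _ _) hc _

lemma pow_frob (l : ℕ) [Fact l.Prime] [Algebra (ZMod l) k] [Algebra.IsAlgebraic (ZMod l) k]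
    (z : k) : ∃ r, 0 < r ∧ z ^ (l ^ r) = z := by
  have hz : IsIntegral (ZMod l) z := (Algebra.IsAlgebraic.isAlgebraic z).isIntegral
  let E := IntermediateField.adjoin (ZMod l) {z}
  have : FiniteDimensional (ZMod l) E := IntermediateField.adjoin.finiteDimensional hz
  have : Finite E := Module.finite_of_finite (ZMod l)
  have : Fintype E := Fintype.ofFinite E
  refine ⟨Module.finrank (ZMod l) E, Module.finrank_pos, ?_⟩
  have hcard : Fintype.card E = l ^ Module.finrank (ZMod l) E := by
    rw [Module.card_eq_pow_finrank (K := ZMod l), ZMod.card]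
  have := FiniteField.pow_card (⟨z, IntermediateField.mem_adjoin_simple_self _ z⟩ : E)
  rw [hcard] at this
  exact congrArg Subtype.val this

lemma pow_frob_iter (l : ℕ) (z : k) (r : ℕ) (h : z ^ (l ^ r) = z) (m : ℕ) :
    z ^ (l ^ (r * m)) = z := by
  induction m with
  | zero => simp
  | succ n ih => rw [Nat.mul_succ, pow_add, pow_mul, ih, h]

lemma slm_mem (k' : Subfield k) (H : Subgroup (GL (Fin 2) k))
    (hSL : ∀ g : GL (Fin 2) k, (∀ i j, g.val i j ∈ k') → g.val.det = 1 → g ∈ H)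
    (a b c d : k) (ha : a ∈ k') (hb : b ∈ k') (hc : c ∈ k') (hd : d ∈ k') (h) :
    slm a b c d h ∈ H := by
  apply hSL
  · intro i j; rw [slm_val]; fin_cases i <;> fin_cases j <;> assumption
  · rw [slm_val, Matrix.det_fin_two]; simpa using h

lemma tt_pow (s : k) (hs) (n : ℕ) : tt s hs ^ n = tt (s ^ n) (pow_ne_zero n hs) := by
  induction n with
  | zero => apply Units.ext; simp [tt_val, Matrix.one_fin_two]
  | succ n ih =>
    rw [pow_succ, ih, tt, tt, tt, slm_mul]
    apply slm_congr
    · ring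
    · ring
    · ring
    · rw [pow_succ]; field_simp; ring

lemma tt_conj_uu (s b : k) (hs) : tt s hs * uu b = uu (s^2*b) * tt s hs := by
  rw [tt, uu, uu, slm_mul, slm_mul]
  apply slm_congr
  all_goals field_simp
  all_goals ring

lemma inv_of_commute (h2 : (2:k) ≠ 0) (X : Matrix (Fin 2) (Fin 2) k) (ht : X.trace = 0)
   (h1 : (uu 1).val * X = X * (uu 1).val) (h3 : (ll 1).val * X = X * (ll 1).val) : X = 0 := by
  rw [uu_val] at h1
  rw [ll_val] at h3
  rw [Matrix.trace_fin_two] at ht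
  have a := congrFun (congrFun h1 0) 0
  have b := congrFun (congrFun h1 0) 1
  have c := congrFun (congrFun h3 0) 0
  simp [Matrix.mul_apply, Fin.sum_univ_two] at a b c
  have e : X 0 0 = 0 := by
    have : 2 * X 0 0 = 0 := by linear_combination ht - b
    simpa [h2] using this
  ext i j; fin_cases i <;> fin_cases j <;> simp
  · exact e
  · exact c
  · exact a
  · linear_combination ht - e

/-- cocycle on `H` -/
def Coc (H : Subgroup (GL (Fin 2) k)) (f : GL (Fin 2) k → Matrix (Fin 2) (Fin 2) k) : Prop :=
  (∀ g ∈ H, (f g).trace = 0) ∧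
    ∀ g ∈ H, ∀ h ∈ H, f (g * h) = f g + g.val * f h * (g⁻¹).val

lemma trace_conjGL (g : GL (Fin 2) k) (X : Matrix (Fin 2) (Fin 2) k) :
    (g.val * X * (g⁻¹).val).trace = X.trace := by
  rw [Matrix.trace_mul_comm, ← mul_assoc, ← Units.val_mul]; simp

lemma Coc.sub {H : Subgroup (GL (Fin 2) k)} {f} (hf : Coc H f) (X : Matrix (Fin 2) (Fin 2) k) :
    Coc H (fun g => f g - (g.val * X * (g⁻¹).val - X)) := by
  refine ⟨fun g hg => ?_, fun g hg h hh => ?_⟩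
  · rw [Matrix.trace_sub, Matrix.trace_sub, trace_conjGL, hf.1 g hg]; simp
  · simp only
    rw [hf.2 g hg h hh, _root_.mul_inv_rev, Units.val_mul, Units.val_mul]
    noncomm_ring

lemma Coc.one {H : Subgroup (GL (Fin 2) k)} {f} (hf : Coc H f) : f 1 = 0 := by
  have := hf.2 1 H.one_mem 1 H.one_mem
  simpa using this

lemma L1 (l : ℕ) [Fact l.Prime] [Algebra (ZMod l) k] [Algebra.IsAlgebraic (ZMod l) k]
    (k' : Subfield k) (H : Subgroup (GL (Fin 2) k))
    (hT : ∀ s ∈ k', ∀ hs, tt s hs ∈ H)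
    (s : k) (hsk : s ∈ k') (hs : s ≠ 0) (hs4 : s ^ 4 ≠ 1) (f) (hf : Coc H f) :
    ∃ X : Matrix (Fin 2) (Fin 2) k, X.trace = 0 ∧
      ∀ a ∈ k', ∀ ha, f (tt a ha) - ((tt a ha).val * X * ((tt a ha)⁻¹).val - X) = 0 := by
  have : CharP k l := charP_of_injective_algebraMap (algebraMap (ZMod l) k).injective l
  have hs2 : s ^ 2 - 1 ≠ 0 := fun h => hs4 (by linear_combination (s^2+1) * h)
  have hs2' : 1 - s ^ 2 ≠ 0 := fun h => hs4 (by linear_combination -(s^2+1) * h)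
  set A := f (tt s hs) with hA
  let X : Matrix (Fin 2) (Fin 2) k := !![0, A 0 1 / (s^2-1); A 1 0 * s ^ 2 / (1 - s^2), 0]
  refine ⟨X, by simp [X, Matrix.trace_fin_two], ?_⟩
  have hf' := hf.sub X
  set F := fun g : GL (Fin 2) k => f g - (g.val * X * (g⁻¹).val - X) with hF
  have h0 : F (tt s hs) 0 1 = 0 ∧ F (tt s hs) 1 0 = 0 := by
    simp only [hF, ← hA, tt_val, tt_inv, X]
    constructor
    · simp [Matrix.mul_apply, Fin.sum_univ_two]
      field_simp
      ring
    · simp [Matrix.mul_apply, Fin.sum_univ_two]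
      field_simp
      ring
  intro a hak ha
  change F (tt a ha) = 0
  have hcomm : tt s hs * tt a ha = tt a ha * tt s hs := by
    rw [tt, tt, slm_mul, slm_mul]; apply slm_congr <;> ring
  have hH := hT a hak ha
  have e1 := hf'.2 _ (hT s hsk hs) _ hH
  rw [hcomm, hf'.2 _ hH _ (hT s hsk hs), tt_val, tt_inv, tt_val, tt_inv] at e1
  have b01 := congrFun (congrFun e1 0) 1
  have b10 := congrFun (congrFun e1 1) 0
  simp only [uu_val, uu_inv, tt_val, tt_inv, ww_val, ww_inv, Matrix.add_apply, Matrix.mul_apply, Fin.sum_univ_two] at b01 b10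
  simp [h0.1, h0.2] at b01 b10
  have c01 : F (tt a ha) 0 1 = 0 := by
    have : (s^2-1) * F (tt a ha) 0 1 = 0 := by linear_combination -b01
    simpa [hs2] using this
  have c10 : F (tt a ha) 1 0 = 0 := by
    have : (1 - s^2) * F (tt a ha) 1 0 = 0 := by
      field_simp at b10
      linear_combination -b10
    simpa [hs2'] using this
  have hconj : (tt a ha).val * F (tt a ha) * ((tt a ha)⁻¹).val = F (tt a ha) := by
    rw [tt_val, tt_inv]
    ext i j
    simp only [Matrix.mul_apply, Fin.sum_univ_two]
    fin_cases i <;> fin_cases j <;> simp [c01, c10] <;> field_simp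
  have hpow : ∀ n : ℕ, F (tt a ha ^ n) = n • F (tt a ha) := by
    intro n
    induction n with
    | zero => simp [hf'.one]
    | succ n ih =>
      rw [pow_succ', hf'.2 _ hH _ (H.pow_mem hH n), ih, succ_nsmul', mul_smul_comm, smul_mul_assoc,
        hconj]
  obtain ⟨r, hr, hrz⟩ := pow_frob l a
  have h3 := hpow (l ^ r)
  have h4 : tt a ha ^ (l^r) = tt a ha := by
    rw [tt_pow]; exact slm_congr hrz rfl rfl (by rw [hrz])
  rw [h4] at h3
  rw [h3, ← Nat.cast_smul_eq_nsmul k, Nat.cast_pow, CharP.cast_eq_zero, zero_pow hr.ne', zero_smul]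

lemma uu_add (a b : k) : uu (a + b) = uu a * uu b := by
  rw [uu, uu, uu, slm_mul]; apply slm_congr <;> ring

lemma L2 (h2 : (2:k) ≠ 0)
    (k' : Subfield k) (H : Subgroup (GL (Fin 2) k))
    (hT : ∀ s ∈ k', ∀ hs, tt s hs ∈ H) (hU : ∀ b ∈ k', uu b ∈ H)
    (s : k) (hsk : s ∈ k') (hs : s ≠ 0) (hs4 : s ^ 4 ≠ 1) (f) (hf : Coc H f)
    (h0 : ∀ a ∈ k', ∀ ha, f (tt a ha) = 0) :
    ∃ η : k, ∀ b ∈ k', f (uu b) = !![0, η * b; 0, 0] := by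
  have hs2 : s ^ 2 - 1 ≠ 0 := fun h => hs4 (by linear_combination (s^2+1) * h)
  have hadd : ∀ b ∈ k', ∀ c ∈ k', f (uu (b + c)) = f (uu b) + (uu b).val * f (uu c) * ((uu b)⁻¹).val := by
    intro b hb c hc
    rw [uu_add, hf.2 _ (hU b hb) _ (hU c hc)]
  have htr : ∀ b ∈ k', f (uu b) 1 1 = - f (uu b) 0 0 := by
    intro b hb
    have := hf.1 _ (hU b hb)
    rw [Matrix.trace_fin_two] at this
    linear_combination this
  have hact : ∀ a ∈ k', ∀ ha : a ≠ 0, ∀ b ∈ k', f (uu (a^2*b)) = (tt a ha).val * f (uu b) * ((tt a ha)⁻¹).val := by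
    intro a hak ha b hb
    have e := hf.2 _ (hT a hak ha) _ (hU b hb)
    have hm : a^2*b ∈ k' := k'.mul_mem (k'.pow_mem hak 2) hb
    rw [tt_conj_uu, hf.2 _ (hU _ hm) _ (hT a hak ha), h0 a hak ha] at e
    simpa using e
  -- z
  have hz1 : ∀ b ∈ k', ∀ c ∈ k', b * f (uu c) 1 0 = c * f (uu b) 1 0 := by
    intro b hb c hc
    have e := hadd b hb c hc
    rw [add_comm b c, hadd c hc b hb] at e
    have e' := congrFun (congrFun e 0) 0
    simp only [uu_val, uu_inv, tt_val, tt_inv, ww_val, ww_inv, Matrix.add_apply, Matrix.mul_apply, Fin.sum_univ_two] at e'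
    simp [uu_val, uu_inv] at e'
    linear_combination -e'
  have hz : ∀ b ∈ k', f (uu b) 1 0 = 0 := by
    have h1 : f (uu 1) 1 0 = 0 := by
      have e := congrFun (congrFun (hact s hsk hs 1 k'.one_mem) 1) 0
      have e2 := hz1 1 k'.one_mem (s^2*1) (k'.mul_mem (k'.pow_mem hsk 2) k'.one_mem)
      rw [e] at e2
      simp only [uu_val, uu_inv, tt_val, tt_inv, ww_val, ww_inv, Matrix.add_apply, Matrix.mul_apply, Fin.sum_univ_two] at e2
      simp [tt_val, tt_inv] at e2
      field_simp at e2
      have : (s^4 - 1) * f (uu 1) 1 0 = 0 := by linear_combination -e2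
      simpa [sub_eq_zero, hs4] using this
    intro b hb
    have := hz1 1 k'.one_mem b hb
    rw [h1] at this
    simpa using this
  have hx : ∀ b ∈ k', f (uu b) 0 0 = 0 := by
    intro b hb
    have hc : b / (s^2-1) ∈ k' := k'.div_mem hb (k'.sub_mem (k'.pow_mem hsk 2) k'.one_mem)
    set c := b / (s^2-1) with hcdef
    have e := hadd b hb c hc
    have eb : b + c = s^2 * c := by rw [hcdef]; field_simp; ring
    rw [eb, hact s hsk hs c hc] at e
    have e' := congrFun (congrFun e 0) 0
    simp only [uu_val, uu_inv, tt_val, tt_inv, ww_val, ww_inv, Matrix.add_apply, Matrix.mul_apply, Fin.sum_univ_two] at e'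
    simp [uu_val, uu_inv, tt_val, tt_inv, hz c hc] at e'
    field_simp at e'
    linear_combination -e'
  have hyadd : ∀ b ∈ k', ∀ c ∈ k', f (uu (b + c)) 0 1 = f (uu b) 0 1 + f (uu c) 0 1 := by
    intro b hb c hc
    have e' := congrFun (congrFun (hadd b hb c hc) 0) 1
    simp only [uu_val, uu_inv, tt_val, tt_inv, ww_val, ww_inv, Matrix.add_apply, Matrix.mul_apply, Fin.sum_univ_two] at e'
    simp [uu_val, uu_inv, hz c hc, hx c hc, htr c hc] at e'
    exact e'
  have hysq : ∀ a ∈ k', f (uu (a^2)) 0 1 = a^2 * f (uu 1) 0 1 := by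
    intro a hak
    by_cases ha : a = 0
    · subst ha
      have := hyadd 0 k'.zero_mem 0 k'.zero_mem
      simpa using this
    · have e' := congrFun (congrFun (hact a hak ha 1 k'.one_mem) 0) 1
      simp only [uu_val, uu_inv, tt_val, tt_inv, ww_val, ww_inv, Matrix.add_apply, Matrix.mul_apply, Fin.sum_univ_two] at e'
      simp [tt_val, tt_inv] at e'
      rw [e']; ring
  refine ⟨f (uu 1) 0 1, fun b hb => ?_⟩
  have hy : f (uu b) 0 1 = f (uu 1) 0 1 * b := by
    have h2k : (2:k) ∈ k' := ofNat_mem k' 2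
    have hp : (b+1)/2 ∈ k' := k'.div_mem (k'.add_mem hb k'.one_mem) h2k
    have hm : (b-1)/2 ∈ k' := k'.div_mem (k'.sub_mem hb k'.one_mem) h2k
    have e := hyadd b hb (((b-1)/2)^2) (k'.pow_mem hm 2)
    have eb : b + ((b-1)/2)^2 = ((b+1)/2)^2 := by field_simp; ring
    rw [eb, hysq _ hp, hysq _ hm] at e
    have : f (uu b) 0 1 = (((b+1)/2)^2 - ((b-1)/2)^2) * f (uu 1) 0 1 := by linear_combination -e
    rw [this, ← eb]; ring
  ext i j; fin_cases i <;> fin_cases j <;> simp [hx b hb, hy, hz b hb, htr b hb]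

lemma L3 (h2 : (2:k) ≠ 0)
    (k' : Subfield k) (H : Subgroup (GL (Fin 2) k))
    (hT : ∀ s ∈ k', ∀ hs, tt s hs ∈ H) (hU : ∀ b ∈ k', uu b ∈ H) (hW : ww ∈ H)
    (s : k) (hsk : s ∈ k') (hs : s ≠ 0) (hs4 : s ^ 4 ≠ 1) (f) (hf : Coc H f)
    (h0 : ∀ a ∈ k', ∀ ha, f (tt a ha) = 0) (hu0 : ∀ b ∈ k', f (uu b) = 0) : f ww = 0 := by
  have hs2 : s ^ 2 - 1 ≠ 0 := fun h => hs4 (by linear_combination (s^2+1) * h)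
  have hsi : s⁻¹ ∈ k' := k'.inv_mem hsk
  have e : tt s hs * ww = ww * tt s⁻¹ (inv_ne_zero hs) := by
    rw [tt, tt, ww, slm_mul, slm_mul]; apply slm_congr <;> simp
  have e1 := hf.2 _ (hT s hsk hs) _ hW
  rw [e, hf.2 _ hW _ (hT _ hsi _), h0 _ hsk, h0 _ hsi] at e1
  have b01 := congrFun (congrFun e1 0) 1
  have b10 := congrFun (congrFun e1 1) 0
  simp only [uu_val, uu_inv, tt_val, tt_inv, ww_val, ww_inv, Matrix.add_apply, Matrix.mul_apply, Fin.sum_univ_two] at b01 b10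
  simp [tt_val, tt_inv] at b01 b10
  have c01 : f ww 0 1 = 0 := by
    have : (s^2-1) * f ww 0 1 = 0 := by linear_combination -b01
    simpa [hs2] using this
  have c10 : f ww 1 0 = 0 := by
    have : (s^2-1) * f ww 1 0 = 0 := by
      field_simp at b10
      linear_combination b10
    simpa [hs2] using this
  have htr := hf.1 _ hW
  rw [Matrix.trace_fin_two] at htr
  have c11 : f ww 1 1 = - f ww 0 0 := by linear_combination htr
  have hg : (ww * uu 1 : GL (Fin 2) k) = slm 0 1 (-1) (-1) (by ring) := by
    rw [ww, uu, slm_mul]; apply slm_congr <;> simp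
  have hgH : slm 0 1 (-1) (-1) (by ring) ∈ H := hg ▸ H.mul_mem hW (hU 1 k'.one_mem)
  set g : GL (Fin 2) k := slm 0 1 (-1) (-1) (by ring) with hgd
  have hfg : f g = f ww := by
    rw [← hg, hf.2 _ hW _ (hU 1 k'.one_mem), hu0 1 k'.one_mem]; simp
  have h3 : g * (g * g) = 1 := by
    rw [hgd, slm_mul, slm_mul]
    apply Units.ext
    rw [slm_val, Units.val_one, Matrix.one_fin_two]
    simp
  have e2 := hf.2 g hgH (g * g) (H.mul_mem hgH hgH)
  rw [h3, hf.one, hf.2 g hgH g hgH, hfg, hgd, slm_val, slm_inv] at e2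
  have d := congrFun (congrFun e2 0) 1
  simp only [uu_val, uu_inv, tt_val, tt_inv, ww_val, ww_inv, Matrix.add_apply, Matrix.mul_apply, Fin.sum_univ_two] at d
  simp [c01, c10, c11] at d
  have c00 : f ww 0 0 = 0 := by
    have : 2 * f ww 0 0 = 0 := by linear_combination d
    simpa [h2] using this
  ext i j; fin_cases i <;> fin_cases j <;> simp [c00, c01, c10, c11]

lemma L4 (k' : Subfield k) (H : Subgroup (GL (Fin 2) k))
    (hU : ∀ b ∈ k', uu b ∈ H) (hW : ww ∈ H)
    (f) (hf : Coc H f) (hu0 : ∀ b ∈ k', f (uu b) = 0) (hw0 : f ww = 0)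
    (g : GL (Fin 2) k) (hg : ∀ i j, g.val i j ∈ k') (hd : g.val.det = 1) : f g = 0 := by
  let K : Subgroup (GL (Fin 2) k) :=
    { carrier := {g | g ∈ H ∧ f g = 0}
      one_mem' := ⟨H.one_mem, hf.one⟩
      mul_mem' := by
        rintro a b ⟨ha, ha'⟩ ⟨hb, hb'⟩
        refine ⟨H.mul_mem ha hb, ?_⟩
        rw [hf.2 a ha b hb, ha', hb']; simp
      inv_mem' := by
        rintro a ⟨ha, ha'⟩
        refine ⟨H.inv_mem ha, ?_⟩
        have := hf.2 a⁻¹ (H.inv_mem ha) a ha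
        rw [inv_mul_cancel, hf.one, ha'] at this
        simpa using this.symm }
  have hKu : ∀ b ∈ k', uu b ∈ K := fun b hb => ⟨hU b hb, hu0 b hb⟩
  have hKw : ww ∈ K := ⟨hW, hw0⟩
  refine (gen k' K hKu ?_ g hg hd).2
  intro b hb
  have : ll b = ww * uu (-b) * ww⁻¹ := by
    rw [eq_mul_inv_iff_mul_eq, ll, uu, ww, slm_mul, slm_mul]
    apply slm_congr <;> simp
  rw [this]
  exact K.mul_mem (K.mul_mem hKw (hKu _ (k'.neg_mem hb))) (K.inv_mem hKw)

lemma conj_mem (k' : Subfield k) (h : GL (Fin 2) k) (c : kˣ)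
    (hc : ∀ i j, ((c⁻¹ : kˣ) : k) * h.val i j ∈ k') (s : GL (Fin 2) k)
    (hs : ∀ i j, s.val i j ∈ k') : ∀ i j, (h⁻¹ * s * h).val i j ∈ k' := by
  have hdet : h.val.det ≠ 0 := by
    have := (Matrix.isUnit_iff_isUnit_det _).1 h.isUnit
    exact this.ne_zero
  have hc0 : (c : k) ≠ 0 := c.ne_zero
  set M : Matrix (Fin 2) (Fin 2) k := ((c⁻¹ : kˣ) : k) • h.val with hM
  have hMk : ∀ i j, M i j ∈ k' := by intro i j; simpa [hM] using hc i j
  have hh : h.val = (c : k) • M := by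
    rw [hM, smul_smul]; simp
  have hMd : M.det ≠ 0 := by
    intro h0; apply hdet; rw [hh, Matrix.det_smul, h0, mul_zero]
  have hinv : (h⁻¹).val = ((c : k)⁻¹ * (M.det)⁻¹) • M.adjugate := by
    rw [Matrix.coe_units_inv]
    apply Matrix.inv_eq_right_inv
    rw [hh, smul_mul_smul_comm, Matrix.mul_adjugate, smul_smul]
    rw [show (c:k) * ((c : k)⁻¹ * (M.det)⁻¹) * M.det = 1 by field_simp, one_smul]
  have key : (h⁻¹ * s * h).val = (M.det)⁻¹ • (M.adjugate * s.val * M) := by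
    rw [Units.val_mul, Units.val_mul, hinv, hh]
    simp only [smul_mul_assoc, mul_smul_comm, smul_smul]
    congr 1
    field_simp
  intro i j
  have hdk : M.det ∈ k' := by
    rw [Matrix.det_fin_two]
    exact k'.sub_mem (k'.mul_mem (hMk _ _) (hMk _ _)) (k'.mul_mem (hMk _ _) (hMk _ _))
  have hak : ∀ i j, M.adjugate i j ∈ k' := by
    intro i j
    rw [Matrix.adjugate_fin_two]
    fin_cases i <;> fin_cases j
    · exact hMk 1 1
    · exact k'.neg_mem (hMk 0 1)
    · exact k'.neg_mem (hMk 1 0)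
    · exact hMk 0 0
  rw [key, Matrix.smul_apply, smul_eq_mul, Matrix.mul_apply]
  refine k'.mul_mem (k'.inv_mem hdk) (k'.sum_mem fun x _ => k'.mul_mem ?_ (hMk _ _))
  rw [Matrix.mul_apply]
  exact k'.sum_mem fun y _ => k'.mul_mem (hak _ _) (hs _ _)

lemma L5 (h2 : (2:k) ≠ 0) (k' : Subfield k) (H : Subgroup (GL (Fin 2) k))
    (hSL : ∀ g : GL (Fin 2) k, (∀ i j, g.val i j ∈ k') → g.val.det = 1 → g ∈ H)
    (hsc : ∀ g ∈ H, ∃ c : kˣ, ∀ i j, ((c⁻¹ : kˣ) : k) * (g : GL (Fin 2) k).val i j ∈ k')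
    (f) (hf : Coc H f)
    (h0 : ∀ g : GL (Fin 2) k, (∀ i j, g.val i j ∈ k') → g.val.det = 1 → f g = 0)
    (h : GL (Fin 2) k) (hh : h ∈ H) : f h = 0 := by
  obtain ⟨c, hc⟩ := hsc h hh
  have key : ∀ s : GL (Fin 2) k, (∀ i j, s.val i j ∈ k') → s.val.det = 1 →
      s.val * f h = f h * s.val := by
    intro s hs hd
    have m := conj_mem k' h c hc s hs
    have d : (h⁻¹ * s * h).val.det = 1 := by
      rw [Units.val_mul, Matrix.det_mul_comm, ← Units.val_mul, mul_inv_cancel_left, hd]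
    have e := hf.2 h hh _ (hSL _ m d)
    rw [h0 _ m d, show h * (h⁻¹ * s * h) = s * h by group, hf.2 s (hSL s hs hd) h hh, h0 s hs hd] at e
    have e2 : s.val * f h * (s⁻¹).val = f h := by simpa using e
    calc s.val * f h = s.val * f h * ((s⁻¹).val * s.val) := by rw [← Units.val_mul]; simp
      _ = _ := by rw [← mul_assoc, e2]
  apply inv_of_commute h2 _ (hf.1 h hh)
  · apply key
    · intro i j; rw [uu_val]; fin_cases i <;> fin_cases j <;> simp [k'.one_mem, k'.zero_mem]
    · simp [uu_val, Matrix.det_fin_two]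
  · apply key
    · intro i j; rw [ll_val]; fin_cases i <;> fin_cases j <;> simp [k'.one_mem, k'.zero_mem]
    · simp [ll_val, Matrix.det_fin_two]

lemma H1 (l : ℕ) [Fact l.Prime] [Algebra (ZMod l) k] [Algebra.IsAlgebraic (ZMod l) k]
    (h2 : (2:k) ≠ 0) (k' : Subfield k) (H : Subgroup (GL (Fin 2) k))
    (hSL : ∀ g : GL (Fin 2) k, (∀ i j, g.val i j ∈ k') → g.val.det = 1 → g ∈ H)
    (hsc : ∀ g ∈ H, ∃ c : kˣ, ∀ i j, ((c⁻¹ : kˣ) : k) * (g : GL (Fin 2) k).val i j ∈ k')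
    (s : k) (hsk : s ∈ k') (hs : s ≠ 0) (hs4 : s ^ 4 ≠ 1) (f) (hf : Coc H f) :
    ∃ X : Matrix (Fin 2) (Fin 2) k, X.trace = 0 ∧
      ∀ g ∈ H, f g = g.val * X * (g⁻¹).val - X := by
  have m := slm_mem k' H hSL
  have hT : ∀ s ∈ k', ∀ hs, tt s hs ∈ H := fun s h hs =>
    m _ _ _ _ h k'.zero_mem k'.zero_mem (k'.inv_mem h) _
  have hU : ∀ b ∈ k', uu b ∈ H := fun b h =>
    m _ _ _ _ k'.one_mem h k'.zero_mem k'.one_mem _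
  have hW : ww ∈ H := m _ _ _ _ k'.zero_mem k'.one_mem (k'.neg_mem k'.one_mem) k'.zero_mem _
  obtain ⟨X, hX, hX0⟩ := L1 l k' H hT s hsk hs hs4 f hf
  have hf1 := hf.sub X
  obtain ⟨η, hη⟩ := L2 h2 k' H hT hU s hsk hs hs4 _ hf1 hX0
  let Y : Matrix (Fin 2) (Fin 2) k := !![-η/2, 0; 0, η/2]
  have hf2 := hf1.sub Y
  have hY0 : Y.trace = 0 := by simp [Y, Matrix.trace_fin_two]; ring
  have q := L3 h2 k' H hT hU hW s hsk hs hs4 _ hf2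
    (by
      intro a hak ha
      have e0 := hX0 a hak ha
      beta_reduce
      rw [e0, tt_val, tt_inv]
      ext i j
      simp only [Matrix.sub_apply, Matrix.mul_apply, Fin.sum_univ_two]
      fin_cases i <;> fin_cases j <;> simp [Y] <;> field_simp <;> ring)
  have hu0 : ∀ b ∈ k', (fun g : GL (Fin 2) k => (fun g : GL (Fin 2) k => f g - (g.val * X * (g⁻¹).val - X)) g - (g.val * Y * (g⁻¹).val - Y)) (uu b) = 0 := by
    intro b hb
    have := hη b hb
    beta_reduce
    rw [this, uu_val, uu_inv]
    ext i j
    simp only [Matrix.sub_apply, Matrix.mul_apply, Fin.sum_univ_two]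
    fin_cases i <;> fin_cases j <;> simp [Y] <;> field_simp <;> ring
  have hw0 := q hu0
  have h4 := L4 k' H hU hW _ hf2 hu0 hw0
  have h5 := L5 h2 k' H hSL hsc _ hf2 h4
  refine ⟨X + Y, by rw [Matrix.trace_add, hX, hY0, add_zero], fun g hg => ?_⟩
  have := h5 g hg
  rw [mul_add, add_mul]
  rw [sub_sub, sub_eq_zero] at this
  rw [this]; abel

set_option maxHeartbeats 1000000 in
lemma noquot (l : ℕ) [Fact l.Prime] [Algebra (ZMod l) k] [Algebra.IsAlgebraic (ZMod l) k]
    (hl : 3 < l) (k' : Subfield k) (H : Subgroup (GL (Fin 2) k))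
    (hSL : ∀ g : GL (Fin 2) k, (∀ i j, g.val i j ∈ k') → g.val.det = 1 → g ∈ H)
    (hsc : ∀ g ∈ H, ∃ c : kˣ, ∀ i j, ((c⁻¹ : kˣ) : k) * (g : GL (Fin 2) k).val i j ∈ k')
    (s : k) (hsk : s ∈ k') (hs : s ≠ 0) (hs4 : s ^ 4 ≠ 1)
    (N : Subgroup H) (hN : N.Normal) (j : ℕ) : Nat.card (H ⧸ N) ≠ l ^ (j + 1) := by
  intro hcard
  have hs2 : s ^ 2 - 1 ≠ 0 := fun h => hs4 (by linear_combination (s^2+1) * h)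
  have m := slm_mem k' H hSL
  have hT : ∀ s ∈ k', ∀ hs, tt s hs ∈ H := fun s h hs =>
    m _ _ _ _ h k'.zero_mem k'.zero_mem (k'.inv_mem h) _
  have hU : ∀ b ∈ k', uu b ∈ H := fun b h =>
    m _ _ _ _ k'.one_mem h k'.zero_mem k'.one_mem _
  have hL : ∀ b ∈ k', ll b ∈ H := fun b h =>
    m _ _ _ _ k'.one_mem k'.zero_mem h k'.one_mem _
  have hpowN : ∀ x : H, x ^ (l ^ (j+1)) ∈ N := by
    intro x
    rw [← hcard]
    have : ((x : H) : H ⧸ N) ^ (Nat.card (H ⧸ N)) = 1 := pow_card_eq_one'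
    rw [← QuotientGroup.mk_pow, QuotientGroup.eq_one_iff] at this
    exact this
  -- elements fixed by a Frobenius power are in N
  have hfix : ∀ x : H, ∀ r, 0 < r → x ^ (l ^ (r * (j+1))) = x → x ∈ N := by
    intro x r hr hx
    have hle : j + 1 ≤ r * (j+1) := Nat.le_mul_of_pos_left _ hr
    obtain ⟨e, he⟩ := Nat.exists_eq_add_of_le hle
    rw [← hx, he, pow_add, pow_mul]
    exact N.pow_mem (hpowN x) _
  let K : Subgroup (GL (Fin 2) k) := N.map H.subtype
  have hK : ∀ x (hx : x ∈ H), x ∈ K ↔ (⟨x, hx⟩ : H) ∈ N := by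
    intro x hx
    constructor
    · rintro ⟨y, hy, rfl⟩; exact hy
    · intro h; exact ⟨_, h, rfl⟩
  have hTN : tt s hs ∈ K := by
    rw [hK _ (hT s hsk hs)]
    obtain ⟨r, hr, hrz⟩ := pow_frob l s
    apply hfix _ r hr
    apply Subtype.ext
    change tt s hs ^ _ = tt s hs
    have := pow_frob_iter l s r hrz (j+1)
    rw [tt_pow]
    exact slm_congr this rfl rfl (by rw [this])
  have hKconj : ∀ x ∈ K, ∀ h ∈ H, h * x * h⁻¹ ∈ K := by
    intro x hx h hh
    obtain ⟨y, hy, rfl⟩ := Subgroup.mem_map.1 hx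
    let h' : H := ⟨h, hh⟩
    have hy' : h' * y * h'⁻¹ ∈ N := hN.conj_mem y hy h'
    have := Subgroup.mem_map_of_mem H.subtype hy'
    rwa [map_mul, map_mul, map_inv] at this
  have hcomm : ∀ x ∈ H, tt s hs * x * (tt s hs)⁻¹ * x⁻¹ ∈ K := by
    intro x hx
    have := K.mul_mem hTN (hKconj _ (K.inv_mem hTN) x hx)
    rwa [show tt s hs * x * (tt s hs)⁻¹ * x⁻¹ = tt s hs * (x * (tt s hs)⁻¹ * x⁻¹) by group]
  have hKu : ∀ b ∈ k', uu b ∈ K := by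
    intro b hb
    have hc : b / (s^2-1) ∈ k' := k'.div_mem hb (k'.sub_mem (k'.pow_mem hsk 2) k'.one_mem)
    have := hcomm _ (hU _ hc)
    rw [tt_conj_uu, mul_inv_cancel_right] at this
    convert this using 1
    rw [eq_mul_inv_iff_mul_eq, ← uu_add]
    congr 1
    field_simp; ring
  have hKl : ∀ b ∈ k', ll b ∈ K := by
    intro b hb
    have hsi : (1 - s^2) ≠ 0 := fun h => hs2 (by linear_combination -h)
    have hc : b * s^2/ (1 - s^2) ∈ k' := k'.div_mem (k'.mul_mem hb (k'.pow_mem hsk 2))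
      (k'.sub_mem k'.one_mem (k'.pow_mem hsk 2))
    have := hcomm _ (hL _ hc)
    convert this using 1
    rw [eq_mul_inv_iff_mul_eq, eq_mul_inv_iff_mul_eq, ll, ll, tt, slm_mul, slm_mul, slm_mul]
    apply slm_congr
    · ring
    · ring
    · field_simp
      ring
    · ring
  have hKS := gen k' K hKu hKl
  have hall : ∀ h ∈ H, h ∈ K := by
    intro h hh
    obtain ⟨c, hc⟩ := hsc h hh
    have hc0 : (c : k) ≠ 0 := c.ne_zero
    have hdet : h.val.det ≠ 0 := ((Matrix.isUnit_iff_isUnit_det _).1 h.isUnit).ne_zero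
    let δ : kˣ := Units.mk0 _ hdet
    let Z : GL (Fin 2) k := Units.map (algebraMap k (Matrix (Fin 2) (Fin 2) k)).toMonoidHom δ
    have hZc : ∀ g, Z * g = g * Z := by
      intro g; apply Units.ext; exact Algebra.commutes _ _
    have hZinv : (Z⁻¹).val = (h.val.det)⁻¹ • (1 : Matrix (Fin 2) (Fin 2) k) := by
      have : Z⁻¹ = Units.map (algebraMap k (Matrix (Fin 2) (Fin 2) k)).toMonoidHom δ⁻¹ := by
        rw [map_inv]
      rw [this]
      exact Algebra.algebraMap_eq_smul_one _
    have hd' : (((c⁻¹ : kˣ) : k) • h.val).det ∈ k' := by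
      rw [Matrix.det_fin_two]
      exact k'.sub_mem (k'.mul_mem (hc _ _) (hc _ _)) (k'.mul_mem (hc _ _) (hc _ _))
    have hv : (Z⁻¹ * (h * h)).val = ((((c⁻¹ : kˣ) : k) • h.val).det)⁻¹ •
        ((((c⁻¹ : kˣ) : k) • h.val) * (((c⁻¹ : kˣ) : k) • h.val)) := by
      rw [Units.val_mul, hZinv, Units.val_mul, smul_mul_assoc, one_mul, smul_mul_smul_comm, smul_smul,
        Matrix.det_smul]
      congr 1
      simp
      field_simp
    have hS : Z⁻¹ * (h * h) ∈ K := by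
      apply hKS
      · intro a b
        rw [hv, Matrix.smul_apply, smul_eq_mul, Matrix.mul_apply]
        exact k'.mul_mem (k'.inv_mem hd') (k'.sum_mem fun x _ => k'.mul_mem (hc _ _) (hc _ _))
      · rw [Units.val_mul, hZinv, Units.val_mul, Matrix.det_mul, Matrix.det_smul, Matrix.det_mul]
        simp
        field_simp
    have hKH : ∀ x ∈ K, x ∈ H := by rintro _ ⟨y, _, rfl⟩; exact y.2
    have hZH : Z ∈ H := by
      have := H.mul_mem (H.mul_mem hh hh) (H.inv_mem (hKH _ hS))
      rwa [show h * h * (Z⁻¹ * (h * h))⁻¹ = Z by group] at this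
    have hZK : Z ∈ K := by
      rw [hK _ hZH]
      obtain ⟨r, hr, hrz⟩ := pow_frob l (δ : k)
      apply hfix _ r hr
      apply Subtype.ext
      change Z ^ _ = Z
      have := pow_frob_iter l _ r hrz (j+1)
      have h' : δ ^ (l ^ (r * (j+1))) = δ := by apply Units.ext; simpa using this
      rw [← map_pow, h']
    have hsq : h ^ 2 ∈ K := by
      have := K.mul_mem hZK hS
      rw [mul_inv_cancel_left] at this
      rwa [pow_two]
    have hpl : h ^ (l ^ (j+1)) ∈ K := ⟨_, hpowN ⟨h, hh⟩, rfl⟩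
    have hodd : Odd (l ^ (j+1)) := ((Fact.out : l.Prime).odd_of_ne_two (by omega)).pow
    obtain ⟨e, he⟩ := hodd
    rw [he, pow_add, pow_mul, pow_one] at hpl
    exact (K.mul_mem_cancel_left (K.pow_mem hsq e)).1 hpl
  have hNtop : N = ⊤ := by
    rw [eq_top_iff]
    rintro ⟨x, hx⟩ _
    exact (hK x hx).1 (hall x hx)
  have h1 : Nat.card (H ⧸ N) = 1 := by
    change N.index = 1
    rw [hNtop, Subgroup.index_top]
  rw [h1] at hcard
  have : 1 < l ^ (j+1) := Nat.one_lt_pow (by omega) (by omega)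
  omega

lemma exists_s (k' : Subfield k) (hfin : (k' : Set k).Finite) (hcard : 5 < Nat.card k') :
    ∃ s ∈ k', s ≠ 0 ∧ s ^ 4 ≠ 1 := by
  classical
  by_contra! hcon
  have : Finite k' := hfin
  have : Fintype k' := Fintype.ofFinite k'
  let p : k[X] := X ^ 5 - X
  have hp : p ≠ 0 := by
    intro h
    have := congrArg (fun q => q.coeff 5) h
    simp [p, coeff_X] at this
  have hpd : p.natDegree ≤ 5 := by
    simp only [p]; compute_degree
  have hsub : hfin.toFinset ⊆ p.roots.toFinset := by
    intro x hx
    rw [Set.Finite.mem_toFinset] at hx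
    rw [Multiset.mem_toFinset, mem_roots hp, IsRoot.def]
    simp only [p, eval_sub, eval_pow, eval_X]
    by_cases h0 : x = 0
    · simp [h0]
    · have := hcon x hx h0
      linear_combination x * this
  have c1 : hfin.toFinset.card = Nat.card k' := by
    rw [← Set.ncard_eq_toFinset_card _ hfin]; rfl
  have := Finset.card_le_card hsub
  have h3 := Multiset.toFinset_card_le p.roots
  have h4 := p.card_roots'
  omega

lemma exists_w (k' : Subfield k) (H : Subgroup (GL (Fin 2) k))
    (hSL : ∀ g : GL (Fin 2) k, (∀ i j, g.val i j ∈ k') → g.val.det = 1 → g ∈ H)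
    (W : Submodule k (Matrix (Fin 2) (Fin 2) k))
    (hW : ∀ w ∈ W, ∀ h : H, (h : GL (Fin 2) k).val * w * ((h : GL (Fin 2) k)⁻¹).val ∈ W)
    (hne : W ≠ ⊥) : ∃ w ∈ W, w 0 0 ≠ 0 := by
  by_contra! hcon
  have m := slm_mem k' H hSL
  have hU : uu 1 ∈ H := m _ _ _ _ k'.one_mem k'.one_mem k'.zero_mem k'.one_mem _
  have hL : ll 1 ∈ H := m _ _ _ _ k'.one_mem k'.zero_mem k'.one_mem k'.one_mem _
  have h10 : ∀ w ∈ W, w 1 0 = 0 := by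
    intro w hw
    have e := hcon _ (hW w hw ⟨_, hU⟩)
    simp only [uu_val, uu_inv, Matrix.mul_apply, Fin.sum_univ_two] at e
    simpa [hcon w hw] using e
  have h01 : ∀ w ∈ W, w 0 1 = 0 := by
    intro w hw
    have e := hcon _ (hW w hw ⟨_, hL⟩)
    simp only [ll_val, ll_inv, Matrix.mul_apply, Fin.sum_univ_two] at e
    simpa [hcon w hw] using e
  have h11 : ∀ w ∈ W, w 1 1 = 0 := by
    intro w hw
    have e := h01 _ (hW w hw ⟨_, hU⟩)
    simp only [uu_val, uu_inv, Matrix.mul_apply, Fin.sum_univ_two] at e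
    simpa [hcon w hw, h01 w hw, h10 w hw] using e
  apply hne
  rw [Submodule.eq_bot_iff]
  intro w hw
  ext i j; fin_cases i <;> fin_cases j <;> simp [hcon w hw, h01 w hw, h10 w hw, h11 w hw]

lemma tt_charpoly (s : k) (hs) : (tt s hs).val.charpoly = (X - C s) * (X - C s⁻¹) := by
  rw [tt_val, Matrix.charpoly_fin_two, Matrix.trace_fin_two, Matrix.det_fin_two]
  simp only [Matrix.of_apply, Matrix.cons_val', Matrix.cons_val_zero, Matrix.cons_val_one,
    Matrix.cons_val_fin_one, map_add, map_sub, map_mul, map_zero]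
  ring

end helpers

/-- let `l > 3` be prime, `k` algebraic over `𝔽_l`, and `k'` a finite
subfield of `k` with more than 5 elements.  If `H ≤ GL₂(k)` satisfies
`SL₂(k') ⊆ H ⊆ k^× GL₂(k')` — i.e. `H` contains every matrix with entries in `k'` of
determinant `1`, and every element of `H` is a scalar (in `k^×`) multiple of a matrix with
entries in `k'` — then `H` is 2-big. -/
theorem isTwoBig_of_between_SL2_and_scalarGL2 (l : ℕ) [Fact l.Prime] (hl : 3 < l)
    (k : Type*) [Field k] [Algebra (ZMod l) k] [Algebra.IsAlgebraic (ZMod l) k]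
    (k' : Subfield k) (hfin : (k' : Set k).Finite) (hcard : 5 < Nat.card k')
    (H : Subgroup (GL (Fin 2) k))
    (hSL : ∀ g : GL (Fin 2) k, (∀ i j, g.val i j ∈ k') → g.val.det = 1 → g ∈ H)
    (hsc : ∀ g ∈ H, ∃ c : kˣ, ∀ i j, ((c⁻¹ : kˣ) : k) * (g : GL (Fin 2) k).val i j ∈ k') :
    IsMBig l 2 H := by
  classical
  obtain ⟨s, hsk, hs, hs4⟩ := exists_s k' hfin hcard
  have : CharP k l := charP_of_injective_algebraMap (algebraMap (ZMod l) k).injective l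
  have h2 : (2:k) ≠ 0 := by
    intro h
    have h' : ((2:ℕ):k) = 0 := by exact_mod_cast h
    have := Nat.le_of_dvd (by norm_num) ((CharP.cast_eq_zero_iff k l 2).1 h')
    omega
  have m := slm_mem k' H hSL
  have hU : uu 1 ∈ H := m _ _ _ _ k'.one_mem k'.one_mem k'.zero_mem k'.one_mem _
  have hL : ll 1 ∈ H := m _ _ _ _ k'.one_mem k'.zero_mem k'.one_mem k'.one_mem _
  have hT : tt s hs ∈ H := m _ _ _ _ hsk k'.zero_mem k'.zero_mem (k'.inv_mem hsk) _
  refine ⟨noquot l hl k' H hSL hsc s hsk hs hs4, ?_, ?_, ?_⟩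
  · intro X hX hc
    exact inv_of_commute h2 X hX (hc ⟨_, hU⟩) (hc ⟨_, hL⟩)
  · intro c hct hcc
    let f : GL (Fin 2) k → Matrix (Fin 2) (Fin 2) k := fun g => if h : g ∈ H then c ⟨g, h⟩ else 0
    have hfv : ∀ g (h : g ∈ H), f g = c ⟨g, h⟩ := fun g h => dif_pos h
    have hf : Coc H f := by
      refine ⟨fun g hg => ?_, fun g hg h hh => ?_⟩
      · rw [hfv g hg]; exact hct _
      · rw [hfv g hg, hfv h hh, hfv _ (H.mul_mem hg hh)]
        exact hcc ⟨g, hg⟩ ⟨h, hh⟩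
    obtain ⟨X, hX, hX'⟩ := H1 l h2 k' H hSL hsc s hsk hs hs4 f hf
    refine ⟨X, hX, fun g => ?_⟩
    rw [← hX' g.1 g.2, hfv g.1 g.2]
  · intro W hW hne _
    obtain ⟨w, hw, hw0⟩ := exists_w k' H hSL W hW hne
    have hss : s ≠ s⁻¹ := by
      intro h
      apply hs4
      have h1 : s * s = 1 := by
        nth_rewrite 2 [h]; exact mul_inv_cancel₀ hs
      linear_combination (s*s+1)*h1
    have hsub : s - s⁻¹ ≠ 0 := sub_ne_zero.2 hss
    refine ⟨⟨_, hT⟩, s, ?_, ?_, w, hw, ?_⟩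
    · simp only [tt_charpoly]
      rw [rootMultiplicity_mul (mul_ne_zero (X_sub_C_ne_zero _) (X_sub_C_ne_zero _)),
        rootMultiplicity_X_sub_C_self, rootMultiplicity_X_sub_C, if_neg hss]
    · intro β hβ hne
      simp only [tt_charpoly, IsRoot.def, eval_mul, eval_sub, eval_X, eval_C, mul_eq_zero,
        sub_eq_zero] at hβ
      rcases hβ with h | h
      · exact absurd h hne
      · intro h'
        apply hs4
        rw [h] at h'
        field_simp at h'
        linear_combination h'
    · intro h0
      have e : eigProj (tt s hs).val s = !![1, 0; 0, 0] := by
        rw [eigProj, tt_val, Matrix.trace_fin_two]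
        ext i j
        fin_cases i <;> fin_cases j <;> simp [hsub]
      simp only [e] at h0
      have := congrFun (congrFun h0 0) 0
      simp only [Matrix.mul_apply, Fin.sum_univ_two] at this
      simp at this
      exact hw0 this
end

section
/- Let l > 5 be a prime and k an algebraic extension of F_l which contains a primitive cube root of unity. Suppose H is a subgroup of GL_2(k) whose image in PGL_2(k) (the quotient of GL_2(k) by its scalar matrices) is isomorphic, as a group, to the alternating group A_5, the symmetric group S_4, or the alternating group A_4. Then H is 2-big. -/
open Matrix Polynomial

/-- The subgroup of scalar matrices in `GL 2 k`. -/
def scalarSubgroup (k : Type*) [Field k] : Subgroup (GL (Fin 2) k) :=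
  (Units.map ((Matrix.scalar (Fin 2)).toMonoidHom : k →* Matrix (Fin 2) (Fin 2) k)).range

instance scalarSubgroup_normal (k : Type*) [Field k] : (scalarSubgroup k).Normal := by
  constructor
  rintro x ⟨c, rfl⟩ g
  refine ⟨c, ?_⟩
  have hcomm :
      (Units.map ((Matrix.scalar (Fin 2)).toMonoidHom : k →* Matrix (Fin 2) (Fin 2) k) c) * g
        = g * Units.map ((Matrix.scalar (Fin 2)).toMonoidHom : k →* Matrix (Fin 2) (Fin 2) k) c := by
    apply Units.ext
    simpa using ((Matrix.scalar_commute (c : k) (fun r => mul_comm _ r) g.val)).eq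
  rw [← hcomm, mul_inv_cancel_right]

section helpers

lemma mem_scal {k : Type*} [Field k] (g : GL (Fin 2) k) :
    g ∈ scalarSubgroup k ↔ ∃ c : k, g.val = c • (1 : Matrix (Fin 2) (Fin 2) k) := by
  constructor
  · rintro ⟨c, rfl⟩
    exact ⟨c, by simp [Matrix.smul_one_eq_diagonal]⟩
  · rintro ⟨c, hc⟩
    have hc0 : c ≠ 0 := by
      rintro rfl
      rw [zero_smul] at hc
      exact g.ne_zero hc
    refine ⟨Units.mk0 c hc0, ?_⟩
    apply Units.ext
    rw [hc]
    simp [Matrix.smul_one_eq_diagonal]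

lemma ch2 {k : Type*} [Field k] (A : Matrix (Fin 2) (Fin 2) k) :
    A * A = A.trace • A - A.det • (1 : Matrix (Fin 2) (Fin 2) k) := by
  ext i j
  fin_cases i <;> fin_cases j <;>
    simp [Matrix.mul_apply, Fin.sum_univ_two, Matrix.trace_fin_two, Matrix.det_fin_two] <;> ring

lemma scal_of_smul {k : Type*} [Field k] (A : Matrix (Fin 2) (Fin 2) k) (s c : k) (hs : s ≠ 0)
    (h : s • A = c • (1 : Matrix (Fin 2) (Fin 2) k)) : A = (s⁻¹ * c) • 1 := by
  rw [mul_smul, ← h, smul_smul, inv_mul_cancel₀ hs, one_smul]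

lemma tr_sq {k : Type*} [Field k] (A : Matrix (Fin 2) (Fin 2) k) (c : k)
    (h3 : A ^ 3 = c • (1 : Matrix (Fin 2) (Fin 2) k))
    (hn : ∀ c : k, A ≠ c • (1 : Matrix (Fin 2) (Fin 2) k)) : A.det = A.trace ^ 2 := by
  by_contra hne
  have hs : A.trace ^ 2 - A.det ≠ 0 := fun h => hne (by linear_combination -h)
  refine hn _ (scal_of_smul A (A.trace ^ 2 - A.det) (c + A.trace * A.det) hs ?_)
  have e : A ^ 3 = A * (A * A) := by noncomm_ring
  rw [e, ch2, mul_sub, mul_smul_comm, ch2, mul_smul_comm, mul_one] at h3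
  rw [add_smul, ← h3]
  module

lemma det_comm_ne {k : Type*} [Field k] (h2 : (2 : k) ≠ 0) (a b : GL (Fin 2) k)
    (hc2 : (a * b * a⁻¹ * b⁻¹) ^ 2 ∈ scalarSubgroup k)
    (hc : a * b * a⁻¹ * b⁻¹ ∉ scalarSubgroup k) :
    (a.val * b.val - b.val * a.val).det ≠ 0 := by
  intro hd
  set u := a * b * a⁻¹ * b⁻¹ with hu
  have e1 : a.val * b.val - b.val * a.val = (u.val - 1) * (b * a).val := by
    have : u * (b * a) = a * b := by rw [hu]; group
    rw [sub_mul, ← Units.val_mul, ← Units.val_mul, ← Units.val_mul, this, one_mul]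
  have hdu : u.val.det = 1 := by
    have : Matrix.GeneralLinearGroup.det u = 1 := by
      rw [hu]; simp
    simpa using congrArg Units.val this
  have hd1 : (u.val - 1).det = 0 := by
    rw [e1, Matrix.det_mul] at hd
    rcases mul_eq_zero.1 hd with h | h
    · exact h
    · exact absurd h ((Matrix.isUnit_iff_isUnit_det _).1 (b * a).isUnit).ne_zero
  have htr : u.val.trace = 2 := by
    rw [Matrix.det_fin_two] at hd1 hdu
    rw [Matrix.trace_fin_two]
    simp at hd1
    linear_combination hdu - hd1
  obtain ⟨c, hcc⟩ := (mem_scal _).1 hc2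
  rw [Units.val_pow_eq_pow_val, pow_two, ch2, htr, hdu] at hcc
  refine hc ((mem_scal _).2 ⟨_, scal_of_smul u.val 2 (c + 1) h2 ?_⟩)
  rw [add_smul, ← hcc]; module

lemma w_zero {k : Type*} [Field k] (a b w : Matrix (Fin 2) (Fin 2) k)
    (hd : (a * b - b * a).det ≠ 0) (h0 : w.trace = 0) (h1 : (w * a).trace = 0)
    (h2 : (w * b).trace = 0) (h3 : (w * (a * b)).trace = 0) : w = 0 := by
  let M : Matrix (Fin 4) (Fin 4) k :=
    !![1, 0, 0, 1;
       a 0 0, a 1 0, a 0 1, a 1 1;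
       b 0 0, b 1 0, b 0 1, b 1 1;
       (a*b) 0 0, (a*b) 1 0, (a*b) 0 1, (a*b) 1 1]
  have hM : M.det = (a * b - b * a).det ∨ M.det = -(a * b - b * a).det := by
    right
    simp [M, Matrix.det_fin_two, Matrix.det_succ_row_zero, Fin.sum_univ_succ, Fin.succAbove, Matrix.mul_apply]
    ring
  have hM0 : M.det ≠ 0 := by
    rcases hM with h | h <;> rw [h]
    · exact hd
    · exact neg_ne_zero.2 hd
  have hv : M *ᵥ ![w 0 0, w 0 1, w 1 0, w 1 1] = 0 := by
    simp only [Matrix.trace_fin_two, Matrix.mul_apply, Fin.sum_univ_two] at h0 h1 h2 h3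
    ext i
    fin_cases i <;>
      simp [M, Matrix.mulVec, dotProduct, Fin.sum_univ_succ, Matrix.mul_apply]
    · linear_combination h0
    · linear_combination h1
    · linear_combination h2
    · linear_combination h3
  have := Matrix.eq_zero_of_mulVec_eq_zero hM0 hv
  have q0 := congrFun this 0
  have q1 := congrFun this 1
  have q2 := congrFun this 2
  have q3 := congrFun this 3
  simp at q0 q1 q2 q3
  ext i j
  fin_cases i <;> fin_cases j <;> simp [*]

lemma w_zero_of_comm {k : Type*} [Field k] (two : (2 : k) ≠ 0)
    (a b w : Matrix (Fin 2) (Fin 2) k)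
    (hd : (a * b - b * a).det ≠ 0) (h0 : w.trace = 0) (h1 : a * w = w * a)
    (h2 : b * w = w * b) : w = 0 := by
  have e : ∀ i j, (a * w) i j = (w * a) i j := fun i j => by rw [h1]
  have f : ∀ i j, (b * w) i j = (w * b) i j := fun i j => by rw [h2]
  have e0 := e 0 0
  have e1 := e 0 1
  have e2 := e 1 0
  have f0 := f 0 0
  have f1 := f 0 1
  have f2 := f 1 0
  simp only [Matrix.mul_apply, Fin.sum_univ_two] at e0 e1 e2 f0 f1 f2
  rw [Matrix.det_fin_two] at hd
  simp only [Matrix.mul_apply, Fin.sum_univ_two, Matrix.sub_apply] at hd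
  rw [Matrix.trace_fin_two] at h0
  have g1 : w 0 1 = 0 := by grind
  have g2 : w 1 0 = 0 := by grind
  have g0 : w 0 0 - w 1 1 = 0 := by grind
  have g3 : w 0 0 = 0 := by
    have : 2 * w 0 0 = 0 := by linear_combination g0 + h0
    exact (mul_eq_zero.1 this).resolve_left two
  have g4 : w 1 1 = 0 := by linear_combination g3 - g0
  ext i j
  fin_cases i <;> fin_cases j <;> simp [*]

/-- one eigenvalue -/
lemma eig_one {k : Type*} [Field k] (A w : Matrix (Fin 2) (Fin 2) k) (α β : k) (hne : α ≠ β)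
    (ht : A.trace = α + β) (hd : A.det = α * β) (h : eigProj A α * w * eigProj A α = 0) :
    (w * A).trace = β * w.trace := by
  have hs : α - β ≠ 0 := sub_ne_zero.2 hne
  have e : eigProj A α = (α - β)⁻¹ • (A - β • (1 : Matrix (Fin 2) (Fin 2) k)) := by
    rw [eigProj, ht]; simp
  have e2 : (A - β • (1 : Matrix (Fin 2) (Fin 2) k)) * (A - β • 1) = (α - β) • (A - β • 1) := by
    rw [sub_mul, mul_sub, ch2, ht, hd]
    simp only [mul_sub, smul_mul_assoc, one_mul, mul_smul_comm, mul_one]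
    module
  have t : (eigProj A α * w * eigProj A α).trace = 0 := by rw [h]; simp
  rw [Matrix.trace_mul_comm, ← mul_assoc, e, smul_mul_smul_comm, e2, smul_smul, smul_mul_assoc,
    Matrix.trace_smul, smul_eq_mul, mul_eq_zero] at t
  rcases t with t | t
  · exact absurd t (mul_ne_zero (mul_ne_zero (inv_ne_zero hs) (inv_ne_zero hs)) hs)
  · rw [sub_mul, Matrix.trace_sub, smul_mul_assoc, one_mul, Matrix.trace_smul, smul_eq_mul,
      Matrix.trace_mul_comm] at t
    exact sub_eq_zero.1 t

lemma charpoly_fac {k : Type*} [Field k] (A : Matrix (Fin 2) (Fin 2) k) (α β : k)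
    (ht : A.trace = α + β) (hd : A.det = α * β) :
    A.charpoly = (X - C α) * (X - C β) := by
  rw [Matrix.charpoly_fin_two, ht, hd, C_add, C_mul]; ring

lemma good_root {k : Type*} [Field k] (A : Matrix (Fin 2) (Fin 2) k) (α β : k)
    (hne : α ^ 2 ≠ β ^ 2)
    (ht : A.trace = α + β) (hd : A.det = α * β) :
    A.charpoly.rootMultiplicity α = 1 ∧
      (∀ γ : k, A.charpoly.IsRoot γ → γ ≠ α → α ^ 2 ≠ γ ^ 2) := by
  classical
  have hne' : α ≠ β := fun h => hne (by rw [h])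
  rw [charpoly_fac A α β ht hd]
  constructor
  · rw [rootMultiplicity_mul (mul_ne_zero (X_sub_C_ne_zero _) (X_sub_C_ne_zero _)),
      rootMultiplicity_X_sub_C_self, rootMultiplicity_X_sub_C, if_neg hne']
  · intro γ hγ hγα
    have : γ = β := by
      simp [IsRoot, sub_eq_zero, hγα] at hγ
      exact hγ
    rw [this]; exact hne

lemma exists_eig {k : Type*} [Field k] (ζ : k) (hζ : IsPrimitiveRoot ζ 3) (h : GL (Fin 2) k)
    (h3 : h ^ 3 ∈ scalarSubgroup k) (hn : h ∉ scalarSubgroup k) :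
    ∃ α β : k, α ^ 2 ≠ β ^ 2 ∧ h.val.trace = α + β ∧ h.val.det = α * β := by
  obtain ⟨c, hc⟩ := (mem_scal _).1 h3
  rw [Units.val_pow_eq_pow_val] at hc
  have hd := tr_sq h.val c hc (fun c hc => hn ((mem_scal _).2 ⟨c, hc⟩))
  have hd0 : h.val.det ≠ 0 := ((Matrix.isUnit_iff_isUnit_det _).1 h.isUnit).ne_zero
  have z3 : ζ ^ 3 = 1 := hζ.pow_eq_one
  have z1 : ζ ≠ 1 := hζ.ne_one (by norm_num)
  have z0 : ζ ≠ 0 := by rintro rfl; simp at z3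
  have zz : 1 + ζ + ζ ^ 2 = 0 := by
    have : (ζ - 1) * (1 + ζ + ζ ^ 2) = 0 := by linear_combination z3
    exact (mul_eq_zero.1 this).resolve_left (sub_ne_zero.2 z1)
  refine ⟨-ζ * h.val.trace, -ζ ^ 2 * h.val.trace, ?_, ?_, ?_⟩
  · intro he
    have : ζ * (ζ - 1) * h.val.det = 0 := by
      rw [hd]; linear_combination he + ζ * h.val.trace ^ 2 * z3
    exact mul_ne_zero (mul_ne_zero z0 (sub_ne_zero.2 z1)) hd0 this
  · linear_combination h.val.trace * zz
  · rw [hd]; linear_combination -h.val.trace ^ 2 * z3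

lemma tors {l : ℕ} [Fact l.Prime] {k : Type*} [Field k] [Algebra (ZMod l) k]
    [Algebra.IsAlgebraic (ZMod l) k] (x : k) (hx : x ≠ 0) :
    ∃ m : ℕ, ¬ l ∣ m ∧ x ^ m = 1 := by
  have hi : IsIntegral (ZMod l) x := (Algebra.IsAlgebraic.isAlgebraic x).isIntegral
  let F := IntermediateField.adjoin (ZMod l) {x}
  have : FiniteDimensional (ZMod l) F := IntermediateField.adjoin.finiteDimensional hi
  have : Finite F := Module.finite_of_finite (ZMod l)
  have : Fintype F := Fintype.ofFinite F
  have : CharP F l := charP_of_injective_algebraMap (algebraMap (ZMod l) F).injective l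
  let y : F := ⟨x, IntermediateField.mem_adjoin_simple_self (ZMod l) x⟩
  have hy : y ≠ 0 := fun h => hx (congrArg Subtype.val h)
  refine ⟨Fintype.card F - 1, ?_, ?_⟩
  · intro hdv
    have h1 : l ∣ Fintype.card F := (CharP.cast_eq_zero_iff F l _).1 (Nat.cast_card_eq_zero F)
    have hp : 0 < Fintype.card F := Fintype.card_pos
    have := (Nat.dvd_sub_iff_right hp h1).1 hdv
    exact (Fact.out : l.Prime).one_lt.ne' (Nat.dvd_one.1 this)
  · have := FiniteField.pow_card_sub_one_eq_one y hy
    exact congrArg Subtype.val this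

lemma tors_scal {l : ℕ} [Fact l.Prime] {k : Type*} [Field k] [Algebra (ZMod l) k]
    [Algebra.IsAlgebraic (ZMod l) k] (g : GL (Fin 2) k) (hg : g ∈ scalarSubgroup k) :
    ∃ m : ℕ, ¬ l ∣ m ∧ g ^ m = 1 := by
  obtain ⟨c, rfl⟩ := hg
  obtain ⟨m, hm, h1⟩ := tors (l := l) (c : k) c.ne_zero
  refine ⟨m, hm, ?_⟩
  rw [← map_pow, (Units.ext (by simpa using h1) : c ^ m = 1), map_one]

lemma perm_data (G : Type*) [Group G] (l : ℕ) [Fact l.Prime] (hl : 5 < l)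
    (h : Nonempty (G ≃* alternatingGroup (Fin 5)) ∨ Nonempty (G ≃* Equiv.Perm (Fin 4)) ∨
      Nonempty (G ≃* alternatingGroup (Fin 4))) :
    Finite G ∧ ¬ l ∣ Nat.card G ∧ ∃ p q : G, p ^ 3 = 1 ∧ q ^ 3 = 1 ∧ (p * q) ^ 3 = 1 ∧
      (p * q * p⁻¹ * q⁻¹) ^ 2 = 1 ∧ p * q * p⁻¹ * q⁻¹ ≠ 1 := by
  have key : ∀ (K : Type) [Group K] [Finite K], Nonempty (G ≃* K) → (Nat.card K ∣ 120) →
     (∃ p q : K, p ^ 3 = 1 ∧ q ^ 3 = 1 ∧ (p * q) ^ 3 = 1 ∧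
      (p * q * p⁻¹ * q⁻¹) ^ 2 = 1 ∧ p * q * p⁻¹ * q⁻¹ ≠ 1) →
     Finite G ∧ ¬ l ∣ Nat.card G ∧ ∃ p q : G, p ^ 3 = 1 ∧ q ^ 3 = 1 ∧ (p * q) ^ 3 = 1 ∧
      (p * q * p⁻¹ * q⁻¹) ^ 2 = 1 ∧ p * q * p⁻¹ * q⁻¹ ≠ 1 := by
    rintro K _ _ ⟨e⟩ hK ⟨p, q, h1, h2, h3, h4, h5⟩
    refine ⟨Finite.of_equiv K e.symm.toEquiv, fun hd => ?_, e.symm p, e.symm q, ?_, ?_, ?_, ?_, ?_⟩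
    · rw [Nat.card_congr e.toEquiv] at hd
      have h6 : l ∣ 2 ^ 3 * 3 * 5 := hd.trans hK
      have hp : l.Prime := Fact.out
      rcases (hp.dvd_mul).1 h6 with h7 | h7
      · rcases (hp.dvd_mul).1 h7 with h8 | h8
        · have := Nat.le_of_dvd (by norm_num) (hp.dvd_of_dvd_pow h8); omega
        · have := Nat.le_of_dvd (by norm_num) h8; omega
      · have := Nat.le_of_dvd (by norm_num) h7; omega
    · rw [← map_pow, h1, map_one]
    · rw [← map_pow, h2, map_one]
    · rw [← map_mul, ← map_pow, h3, map_one]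
    · rw [← map_mul, ← map_inv, ← map_inv, ← map_mul, ← map_mul, ← map_pow, h4, map_one]
    · rw [← map_mul, ← map_inv, ← map_inv, ← map_mul, ← map_mul]
      exact fun h => h5 (e.symm.injective (h.trans (map_one _).symm))
  rcases h with h | h | h
  · refine key _ h ?_ ?_
    · rw [nat_card_alternatingGroup]; simp; decide
    · refine ⟨⟨Equiv.swap 0 1 * Equiv.swap 1 2, Equiv.Perm.mem_alternatingGroup.2 (by decide)⟩,
        ⟨Equiv.swap 1 0 * Equiv.swap 0 3, Equiv.Perm.mem_alternatingGroup.2 (by decide)⟩, ?_⟩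
      decide
  · refine key _ h ?_ ?_
    · rw [Nat.card_perm]; simp; decide
    · refine ⟨Equiv.swap 0 1 * Equiv.swap 1 2,
        Equiv.swap 1 0 * Equiv.swap 0 3, ?_⟩
      decide
  · refine key _ h ?_ ?_
    · rw [nat_card_alternatingGroup]; simp; decide
    · refine ⟨⟨Equiv.swap 0 1 * Equiv.swap 1 2, Equiv.Perm.mem_alternatingGroup.2 (by decide)⟩,
        ⟨Equiv.swap 1 0 * Equiv.swap 0 3, Equiv.Perm.mem_alternatingGroup.2 (by decide)⟩, ?_⟩
      decide

end helpers

/-- let `l > 5` be prime and `k` an algebraic extension of `𝔽_l`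
containing a primitive cube root of unity.  If `H ≤ GL₂(k)` has image in
`PGL₂(k) = GL₂(k)/(scalars)` isomorphic to `A₅`, `S₄` or `A₄`, then `H` is 2-big. -/
theorem isTwoBig_of_projImage_hedral (l : ℕ) [Fact l.Prime] (hl : 5 < l)
    (k : Type*) [Field k] [Algebra (ZMod l) k] [Algebra.IsAlgebraic (ZMod l) k]
    (ζ : k) (hζ : IsPrimitiveRoot ζ 3)
    (H : Subgroup (GL (Fin 2) k))
    (hproj :
      Nonempty ((Subgroup.map (QuotientGroup.mk' (scalarSubgroup k)) H) ≃*
          alternatingGroup (Fin 5)) ∨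
      Nonempty ((Subgroup.map (QuotientGroup.mk' (scalarSubgroup k)) H) ≃*
          Equiv.Perm (Fin 4)) ∨
      Nonempty ((Subgroup.map (QuotientGroup.mk' (scalarSubgroup k)) H) ≃*
          alternatingGroup (Fin 4))) :
    IsMBig l 2 H := by
  set P := Subgroup.map (QuotientGroup.mk' (scalarSubgroup k)) H with hP
  obtain ⟨hfin, hcard, p, q, hp3, hq3, hpq3, hcm2, hcm⟩ := perm_data P l hl hproj
  have hlp : l.Prime := Fact.out
  have hchar : CharP k l := charP_of_injective_algebraMap (algebraMap (ZMod l) k).injective l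
  have cast_ne : ∀ m : ℕ, ¬ l ∣ m → (m : k) ≠ 0 := fun m hm h =>
    hm ((CharP.cast_eq_zero_iff k l m).1 h)
  have two_ne : (2 : k) ≠ 0 := by
    have := cast_ne 2 (fun h => by have := Nat.le_of_dvd (by norm_num) h; omega)
    exact_mod_cast this
  let π : H →* P := (QuotientGroup.mk' (scalarSubgroup k)).subgroupMap H
  have πsurj : Function.Surjective π := MonoidHom.subgroupMap_surjective _ _
  have πone : ∀ h : H, π h = 1 ↔ (h : GL (Fin 2) k) ∈ scalarSubgroup k := by
    intro h
    rw [← Subtype.coe_inj]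
    exact QuotientGroup.eq_one_iff _
  obtain ⟨a, rfl⟩ := πsurj p
  obtain ⟨b, rfl⟩ := πsurj q
  replace hp3 : π (a ^ 3) = 1 := by rw [map_pow]; exact hp3
  replace hq3 : π (b ^ 3) = 1 := by rw [map_pow]; exact hq3
  replace hpq3 : π ((a * b) ^ 3) = 1 := by rw [map_pow, map_mul]; exact hpq3
  replace hcm2 : π ((a * b * a⁻¹ * b⁻¹) ^ 2) = 1 := by
    simp only [map_pow, map_mul, map_inv]; exact hcm2
  replace hcm : π (a * b * a⁻¹ * b⁻¹) ≠ 1 := by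
    simp only [map_mul, map_inv]; exact hcm
  have ha1 : π a ≠ 1 := by
    intro h; apply hcm; simp [h]
  have hb1 : π b ≠ 1 := by
    intro h; apply hcm; simp [h]
  have hab1 : π (a * b) ≠ 1 := by
    intro h; apply hcm
    rw [map_mul] at h
    have : π b = (π a)⁻¹ := (inv_eq_of_mul_eq_one_right h).symm
    simp [this]
  rw [πone] at hp3 hq3 hpq3 hcm2
  rw [Ne, πone] at ha1 hb1 hab1 hcm
  refine ⟨?_, ?_, ?_, ?_⟩
  · -- no quotient of l-power order
    intro N hN j hj
    have hfq : Finite (H ⧸ N) := Nat.finite_of_card_ne_zero (by rw [hj]; exact pow_ne_zero _ hlp.ne_zero)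
    obtain ⟨x, hx⟩ := exists_prime_orderOf_dvd_card' (G := H ⧸ N) l (by rw [hj]; exact dvd_pow_self _ (by omega))
    obtain ⟨h, rfl⟩ := QuotientGroup.mk_surjective x
    have h1 : h ^ Nat.card P ∈ π.ker := by
      rw [MonoidHom.mem_ker, map_pow, pow_card_eq_one']
    rw [MonoidHom.mem_ker, πone] at h1
    obtain ⟨m, hm, h2⟩ := tors_scal (l := l) _ h1
    have h3 : h ^ (Nat.card P * m) = 1 := by
      apply Subtype.ext
      rw [pow_mul]
      exact h2
    have h4 : orderOf (h : H ⧸ N) ∣ Nat.card P * m := by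
      apply orderOf_dvd_of_pow_eq_one
      rw [← QuotientGroup.mk_pow, h3, QuotientGroup.mk_one]
    rw [hx] at h4
    rcases (hlp.dvd_mul).1 h4 with h5 | h5
    · exact hcard h5
    · exact hm h5
  · -- invariants
    intro X hX hcomm
    refine w_zero_of_comm two_ne a.1.val b.1.val X (det_comm_ne two_ne _ _ hcm2 hcm) hX (hcomm a) (hcomm b)
  · -- cocycles
    intro c hc0 hc
    have c1 : c 1 = 0 := by
      have := hc 1 1
      simpa using this
    have cz : ∀ z : H, (z : GL (Fin 2) k) ∈ scalarSubgroup k → c z = 0 := by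
      intro z hz
      have act : ∀ M : Matrix (Fin 2) (Fin 2) k,
          (z : GL (Fin 2) k).val * M * ((z : GL (Fin 2) k)⁻¹).val = M := by
        intro M
        obtain ⟨d, hd⟩ := (mem_scal _).1 hz
        have : (z : GL (Fin 2) k).val * M = M * (z : GL (Fin 2) k).val := by
          rw [hd]; simp
        rw [this, mul_assoc, ← Units.val_mul, mul_inv_cancel, Units.val_one, mul_one]
      have hpow : ∀ n : ℕ, c (z ^ n) = (n : k) • c z := by
        intro n
        induction n with
        | zero => simp [c1]
        | succ n ih =>
          rw [pow_succ', hc, act, ih]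
          push_cast
          module
      obtain ⟨m, hm, h2⟩ := tors_scal (l := l) _ hz
      have h3 : z ^ m = 1 := Subtype.ext h2
      have h4 := hpow m
      rw [h3, c1] at h4
      exact (smul_eq_zero.1 h4.symm).resolve_left (cast_ne m hm)
    have cw : ∀ g g' : H, π g = π g' → c g = c g' := by
      intro g g' hgg
      have hz : π (g⁻¹ * g') = 1 := by rw [map_mul, map_inv, hgg, inv_mul_cancel]
      have h1 := hc g (g⁻¹ * g')
      rw [cz _ ((πone _).1 hz), mul_inv_cancel_left] at h1
      simpa using h1.symm
    choose s hs using πsurj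
    have : Fintype P := Fintype.ofFinite P
    let S := ∑ x : P, c (s x)
    have hN : (Nat.card P : k) ≠ 0 := cast_ne _ hcard
    have hS : ∀ g : H, (g : GL (Fin 2) k).val * S * ((g : GL (Fin 2) k)⁻¹).val
        = S - (Nat.card P : k) • c g := by
      intro g
      have e1 : ∀ x : P, (g : GL (Fin 2) k).val * c (s x) * ((g : GL (Fin 2) k)⁻¹).val
          = c (s (π g * x)) - c g := by
        intro x
        rw [← cw (g * s x) (s (π g * x)) (by rw [map_mul, hs, hs]), hc g (s x)]
        abel
      simp only [S]
      rw [Finset.mul_sum, Finset.sum_mul, Finset.sum_congr rfl (fun x _ => e1 x),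
        Finset.sum_sub_distrib, Finset.sum_const,
        Fintype.sum_equiv (Equiv.mulLeft (π g)) (fun x => c (s (π g * x))) (fun x => c (s x))
          (fun _ => rfl), Finset.card_univ, Nat.card_eq_fintype_card, Nat.cast_smul_eq_nsmul]
    refine ⟨-(Nat.card P : k)⁻¹ • S, ?_, ?_⟩
    · simp [S, Matrix.trace_sum, hc0]
    · intro g
      rw [mul_smul_comm, smul_mul_assoc, hS, smul_sub, smul_smul, neg_mul, inv_mul_cancel₀ hN]
      module
  · -- irreducible submodules
    intro W _ hW _
    by_contra hcon
    apply hW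
    rw [Submodule.eq_bot_iff]
    intro w hw
    have key : ∀ h : H, (h : GL (Fin 2) k) ^ 3 ∈ scalarSubgroup k →
        (h : GL (Fin 2) k) ∉ scalarSubgroup k →
        w.trace = 0 ∧ (w * (h : GL (Fin 2) k).val).trace = 0 := by
      intro h h3 h1
      obtain ⟨α, β, hne, ht, hd⟩ := exists_eig ζ hζ _ h3 h1
      have hne' : α ≠ β := fun h => hne (by rw [h])
      have z1 : eigProj (h : GL (Fin 2) k).val α * w * eigProj (h : GL (Fin 2) k).val α = 0 := by
        by_contra hz
        obtain ⟨r1, r2⟩ := good_root _ α β hne ht hd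
        exact hcon ⟨h, α, r1, r2, w, hw, hz⟩
      have z2 : eigProj (h : GL (Fin 2) k).val β * w * eigProj (h : GL (Fin 2) k).val β = 0 := by
        by_contra hz
        obtain ⟨r1, r2⟩ := good_root _ β α hne.symm (ht.trans (add_comm _ _)) (hd.trans (mul_comm _ _))
        exact hcon ⟨h, β, r1, r2, w, hw, hz⟩
      have t1 := eig_one _ w α β hne' ht hd z1
      have t2 := eig_one _ w β α hne'.symm (ht.trans (add_comm _ _)) (hd.trans (mul_comm _ _)) z2
      have t3 : w.trace = 0 := by
        have : (α - β) * w.trace = 0 := by linear_combination t1 - t2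
        exact (mul_eq_zero.1 this).resolve_left (sub_ne_zero.2 hne')
      exact ⟨t3, by rw [t1, t3, mul_zero]⟩
    exact w_zero a.1.val b.1.val w (det_comm_ne two_ne _ _ hcm2 hcm) (key a hp3 ha1).1
      (key a hp3 ha1).2 (key b hq3 hb1).2 (by simpa using (key (a * b) hpq3 hab1).2)
end

section
/- Let l > 5 be a prime and k an algebraic extension of F_l which contains a primitive cube root of unity. Let G be a group isomorphic to one of: the alternating group A_4, the alternating group A_5, SL_2(F_3) (the binary tetrahedral group 2.A_4), or SL_2(F_5) (the binary icosahedral group 2.A_5). Let r : G → GL_2(k) be an injective group homomorphism such that k^2 is irreducible as a k[G]-module via r. Then the image r(G) is a 2-big subgroup of GL_2(k). -/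
open Matrix Polynomial

theorem hed_pow_nil {k : Type*} [Field k] (C : Matrix (Fin 2) (Fin 2) k)
    (h : (C - 1) * (C - 1) = 0) (n : ℕ) (hn : (n : k) ≠ 0) (hC : C ^ n = 1) : C = 1 := by
  have key : ∀ m : ℕ, C ^ m = 1 + (m : k) • (C - 1) := by
    intro m
    induction m with
    | zero => simp
    | succ m ih =>
      have h2 : C = (C - 1) + 1 := by simp
      rw [pow_succ, ih]
      nth_rewrite 2 [h2]
      rw [mul_add, add_mul, smul_mul_assoc, h, mul_one]
      push_cast
      rw [add_smul]
      simp
      abel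
  have := key n
  rw [hC] at this
  have h3 : (n : k) • (C - 1) = 0 := by
    simpa using this.symm
  rcases smul_eq_zero.mp h3 with h4 | h4
  · exact absurd h4 hn
  · exact sub_eq_zero.mp h4

theorem hed_wN {k : Type*} [Field k] (h2 : (2 : k) ≠ 0) (a b w : Matrix (Fin 2) (Fin 2) k)
    (h0 : w.trace = 0) (ha : (w * a).trace = 0) (hb : (w * b).trace = 0)
    (hab : (w * (a * b)).trace = 0) : w * (a * b - b * a) = 0 := by
  simp only [Matrix.trace_fin_two, Matrix.mul_apply, Fin.sum_univ_two] at *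
  have hd : w 1 1 = - w 0 0 := by linear_combination h0
  rw [hd] at *
  ext i j
  fin_cases i <;> fin_cases j <;>
    simp [Matrix.mul_apply, Fin.sum_univ_two, hd]
  all_goals grind

theorem hed_XN {k : Type*} [Field k] (h2 : (2 : k) ≠ 0) (a b X : Matrix (Fin 2) (Fin 2) k)
    (h0 : X.trace = 0) (ha : a * X = X * a) (hb : b * X = X * b) :
    X * (a * b - b * a) = 0 := by
  set N := a * b - b * a with hN
  have hc : N * X = X * N := by
    rw [hN, sub_mul, mul_sub, mul_assoc, mul_assoc, hb, ha, ← mul_assoc, ← mul_assoc, ha, hb,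
      mul_assoc, mul_assoc]
  have htr : (X * N).trace = 0 := by
    rw [hN, mul_sub, trace_sub, ← mul_assoc, ← mul_assoc, ← ha, mul_assoc a, trace_mul_comm a,
      sub_self]
  have hNt : N.trace = 0 := by rw [hN, trace_sub, trace_mul_comm, sub_self]
  have hac : X * N + N * X = 0 := by
    have h3 : X * N + N * X = (X * N).trace • (1 : Matrix (Fin 2) (Fin 2) k) := by
      clear_value N
      simp only [Matrix.trace_fin_two] at h0 hNt
      have e1 : X 1 1 = - X 0 0 := by linear_combination h0
      have e2 : N 1 1 = - N 0 0 := by linear_combination hNt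
      ext i j
      fin_cases i <;> fin_cases j <;>
        simp [Matrix.mul_apply, Fin.sum_univ_two, Matrix.trace_fin_two, e1, e2] <;> ring
    rw [h3, htr, zero_smul]
  rw [hc, ← two_smul k] at hac
  exact (smul_eq_zero.mp hac).resolve_left h2

theorem hed_CH {k : Type*} [Field k] (C : Matrix (Fin 2) (Fin 2) k) (α β : k)
    (ht : C.trace = α + β) (hd : C.det = α * β) :
    (C - α • 1) * (C - β • 1) = 0 := by
  rw [Matrix.trace_fin_two] at ht
  rw [Matrix.det_fin_two] at hd
  ext i j
  fin_cases i <;> fin_cases j <;>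
    simp [Matrix.mul_apply, Fin.sum_univ_two]
  · linear_combination (C 0 0) * ht - hd
  · linear_combination (C 0 1) * ht
  · linear_combination (C 1 0) * ht
  · linear_combination (C 1 1) * ht - hd

theorem hed_comm {k : Type*} [Field k] (a b : GL (Fin 2) k) (n : ℕ) (hn : (n : k) ≠ 0)
    (hc : (a * b * a⁻¹ * b⁻¹) ^ n = 1) (hd : (a.val * b.val - b.val * a.val).det = 0) :
    a * b = b * a := by
  set c := a * b * a⁻¹ * b⁻¹ with hcdef
  have h1 : a * b = c * (b * a) := by rw [hcdef]; group
  have h2 : a.val * b.val - b.val * a.val = (c.val - 1) * (b * a).val := by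
    rw [sub_mul, one_mul, ← Units.val_mul, ← Units.val_mul, ← Units.val_mul, ← h1]
  have hdet1 : c.val.det = 1 := by
    have : Matrix.GeneralLinearGroup.det c = 1 := by
      rw [hcdef]; simp only [map_mul, map_inv]
      rw [mul_comm (Matrix.GeneralLinearGroup.det a)]; group
    have := congrArg Units.val this
    simpa using this
  have hdet2 : (c.val - 1).det = 0 := by
    rw [h2, Matrix.det_mul] at hd
    refine (mul_eq_zero.mp hd).resolve_right ?_
    exact (Matrix.isUnits_det_units (b * a)).ne_zero
  have htr : c.val.trace = 1 + 1 := by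
    rw [Matrix.det_fin_two] at hdet1 hdet2
    rw [Matrix.trace_fin_two]
    simp at hdet2
    linear_combination hdet1 - hdet2
  have hch := hed_CH c.val 1 1 htr (by rw [hdet1, one_mul])
  rw [one_smul] at hch
  have hc1 : c.val = 1 := hed_pow_nil c.val hch n hn (by
    rw [← Units.val_pow_eq_pow_val, hc, Units.val_one])
  have : c = 1 := Units.ext hc1
  rw [h1, this, one_mul]

theorem hed_eig {k : Type*} [Field k] (h6 : ((6 : ℕ) : k) ≠ 0) (ζ : k) (hζ : IsPrimitiveRoot ζ 3)
    (A : Matrix (Fin 2) (Fin 2) k) (hA : A ^ 6 = 1) (hs : ∀ s : k, A ^ 2 ≠ s • 1) :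
    ∃ α β : k, A.trace = α + β ∧ A.det = α * β ∧ α ≠ β ∧ α ^ 2 ≠ β ^ 2 := by
  have hz : ζ ^ 2 + ζ + 1 = 0 := by
    have := hζ.geom_sum_eq_zero (by norm_num)
    simp [Finset.sum_range_succ] at this
    linear_combination this
  have hex : ∃ α : k, α ^ 6 = 1 ∧ (A - α • 1).det = 0 := by
    have hz3 : ζ ^ 3 = 1 := hζ.pow_eq_one
    have hp : (X - C 1) * (X - C ζ) * (X - C (ζ^2)) * (X - C (-1)) * (X - C (-ζ)) *
        (X - C (-ζ^2)) = (X ^ 6 - 1 : k[X]) := by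
      have hz' : (C ζ) ^ 2 + C ζ + 1 = (0 : k[X]) := by
        rw [← C_pow, ← C_add, ← C_1, ← C_add, hz, C_0]
      simp only [C_neg, C_pow, C_1]
      grind
    have hq := congrArg (fun p => (aeval A p).det) hp
    simp only [map_mul, map_sub, aeval_X, aeval_C, map_pow, map_one, hA, sub_self,
      Matrix.det_mul, Algebra.algebraMap_eq_smul_one] at hq
    rw [Matrix.det_zero] at hq
    have h6' : ζ ^ 6 = 1 := by rw [show 6 = 3 * 2 from rfl, pow_mul, hz3, one_pow]
    simp only [mul_eq_zero] at hq
    rcases hq with ((((hq | hq) | hq) | hq) | hq) | hq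
    · exact ⟨1, by simp, by simpa using hq⟩
    · exact ⟨ζ, h6', hq⟩
    · exact ⟨ζ ^ 2, by rw [← pow_mul, mul_comm, pow_mul, h6', one_pow], by simpa [_root_.smul_pow] using hq⟩
    · exact ⟨-1, by norm_num, by simpa using hq⟩
    · exact ⟨-ζ, by rw [Even.neg_pow (by decide), h6'], by simpa using hq⟩
    · exact ⟨-ζ ^ 2, by
        rw [Even.neg_pow (by decide), ← pow_mul, mul_comm, pow_mul, h6', one_pow],
        by simpa [_root_.smul_pow] using hq⟩
  obtain ⟨α, hα, hdet⟩ := hex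
  have hα0 : α ≠ 0 := by rintro rfl; simp at hα
  have hd : A.det = α * (A.trace - α) := by
    rw [Matrix.det_fin_two] at hdet ⊢
    rw [Matrix.trace_fin_two]
    simp at hdet
    linear_combination hdet
  have ht : A.trace = α + (A.trace - α) := by ring
  generalize A.trace - α = β at *
  have hch := hed_CH A α β ht hd
  have hne : α ≠ β := by
    rintro rfl
    have : α⁻¹ • A = 1 := by
      refine hed_pow_nil _ ?_ 6 h6 ?_
      · have : α⁻¹ • A - 1 = α⁻¹ • (A - α • 1) := by
          rw [smul_sub, smul_smul, inv_mul_cancel₀ hα0, one_smul]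
        rw [this, smul_mul_smul_comm, hch, smul_zero]
      · rw [_root_.smul_pow, hA, inv_pow, hα, inv_one, one_smul]
    have hA' : A = α • 1 := by
      rw [← this, smul_smul, mul_inv_cancel₀ hα0, one_smul]
    exact hs (α ^ 2) (by rw [hA', _root_.smul_pow, one_pow])
  refine ⟨α, β, ht, hd, hne, ?_⟩
  intro h
  have hb : β = -α := by
    have : (α - β) * (α + β) = 0 := by linear_combination h
    have := (mul_eq_zero.mp this).resolve_left (sub_ne_zero.mpr hne)
    linear_combination this
  subst hb
  apply hs (α ^ 2)
  rw [neg_smul, sub_neg_eq_add] at hch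
  have h5 : (A - α • 1) * (A + α • 1) = A ^ 2 - α ^ 2 • 1 := by
    rw [sub_mul, mul_add, mul_add, smul_mul_assoc, smul_mul_assoc, one_mul, one_mul,
      mul_smul_comm, mul_one, smul_smul, ← pow_two, ← pow_two]
    abel
  rw [h5] at hch
  exact sub_eq_zero.mp hch

theorem hed_trace_e {k : Type*} [Field k] (A w : Matrix (Fin 2) (Fin 2) k) (α β : k)
    (ht : A.trace = α + β) (hd : A.det = α * β) (hne : α ≠ β)
    (h : eigProj A α * w * eigProj A α = 0) : (w * (A - β • 1)).trace = 0 := by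
  have hs : α - β ≠ 0 := sub_ne_zero.mpr hne
  have hβ : A.trace - α = β := by rw [ht]; ring
  unfold eigProj at h
  rw [hβ] at h
  rw [smul_mul_assoc, smul_mul_assoc, mul_smul_comm] at h
  have h1 : (A - β • 1) * w * (A - β • 1) = 0 := by
    have := (smul_eq_zero.mp h).resolve_left (inv_ne_zero hs)
    exact (smul_eq_zero.mp this).resolve_left (inv_ne_zero hs)
  have h2 : (A - β • 1) * (A - β • 1) = (α - β) • (A - β • 1) := by
    have := hed_CH A α β ht hd
    have e : A - β • (1 : Matrix (Fin 2) (Fin 2) k) = (A - α • 1) + (α - β) • 1 := by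
      rw [sub_smul]; abel
    nth_rewrite 1 [e]
    rw [add_mul, this, zero_add, smul_mul_assoc, one_mul]
  have h3 := congrArg Matrix.trace h1
  rw [trace_zero, mul_assoc, trace_mul_comm, mul_assoc, h2, mul_smul_comm, trace_smul] at h3
  exact (smul_eq_zero.mp h3).resolve_left hs

theorem hed_good {k : Type*} [Field k] (h6 : ((6 : ℕ) : k) ≠ 0) (ζ : k) (hζ : IsPrimitiveRoot ζ 3)
    (A : Matrix (Fin 2) (Fin 2) k) (hA : A ^ 6 = 1) (hs : ∀ s : k, A ^ 2 ≠ s • 1)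
    (w : Matrix (Fin 2) (Fin 2) k)
    (hw : ∀ α : k, A.charpoly.rootMultiplicity α = 1 →
      (∀ β : k, A.charpoly.IsRoot β → β ≠ α → α ^ 2 ≠ β ^ 2) →
      eigProj A α * w * eigProj A α = 0) :
    w.trace = 0 ∧ (w * A).trace = 0 := by
  classical
  obtain ⟨α, β, ht, hd, hne, hne2⟩ := hed_eig h6 ζ hζ A hA hs
  have key : ∀ α β : k, A.trace = α + β → A.det = α * β → α ≠ β → α ^ 2 ≠ β ^ 2 →
      (w * (A - β • 1)).trace = 0 := by
    intro α β ht hd hne hne2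
    have hcp : A.charpoly = (X - C α) * (X - C β) := by
      rw [Matrix.charpoly_fin_two, ht, hd, C_add, C_mul]; ring
    refine hed_trace_e A w α β ht hd hne (hw α ?_ ?_)
    · rw [hcp, Polynomial.rootMultiplicity_mul
        (mul_ne_zero (X_sub_C_ne_zero _) (X_sub_C_ne_zero _)),
        rootMultiplicity_X_sub_C_self, rootMultiplicity_X_sub_C, if_neg hne]
    · intro γ hγ hγα
      rw [hcp, IsRoot, eval_mul, mul_eq_zero] at hγ
      simp only [eval_sub, eval_X, eval_C] at hγ
      rcases hγ with hγ | hγ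
      · exact absurd (sub_eq_zero.mp hγ) hγα
      · rw [sub_eq_zero.mp hγ]; exact hne2
  have e1 := key α β ht hd hne hne2
  have e2 := key β α (by rw [ht, add_comm]) (by rw [hd, mul_comm]) hne.symm hne2.symm
  rw [mul_sub, trace_sub, mul_smul_comm, mul_one, trace_smul, smul_eq_mul] at e1 e2
  have h0 : w.trace = 0 := by
    have : (α - β) * w.trace = 0 := by linear_combination e1 - e2
    exact (mul_eq_zero.mp this).resolve_left (sub_ne_zero.mpr hne)
  refine ⟨h0, ?_⟩
  rw [h0, mul_zero, sub_zero] at e1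
  exact e1

theorem hed_dvd {l : ℕ} (hp : l.Prime) (hl : 5 < l) {n : ℕ} (h : n ∣ 480) : ¬ l ∣ n := by
  intro h1
  have h2 : l ∣ 2 ^ 5 * 3 * 5 := h1.trans h
  rcases (hp.dvd_mul).mp h2 with h3 | h3
  · rcases (hp.dvd_mul).mp h3 with h4 | h4
    · have := Nat.le_of_dvd (by norm_num) (hp.dvd_of_dvd_pow h4); omega
    · have := Nat.le_of_dvd (by norm_num) h4; omega
  · have := Nat.le_of_dvd (by norm_num) h3; omega

/-- the group-theoretic input -/
def HedFact (G : Type*) [Group G] : Prop :=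
  Finite G ∧ Nat.card G ∣ 480 ∧ ∃ a b : G, a ^ 3 = 1 ∧ b ^ 3 = 1 ∧ (a * b) ^ 6 = 1 ∧
    a * b ≠ b * a ∧ (a * b) ^ 2 * a ≠ a * (a * b) ^ 2

theorem HedFact.of_equiv {G G' : Type*} [Group G] [Group G'] (e : G ≃* G') (h : HedFact G') :
    HedFact G := by
  obtain ⟨hf, hc, a, b, h1, h2, h3, h4, h5⟩ := h
  refine ⟨Finite.of_equiv _ e.symm.toEquiv, by rwa [Nat.card_congr e.toEquiv],
    e.symm a, e.symm b, ?_, ?_, ?_, ?_, ?_⟩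
  · rw [← map_pow, h1, map_one]
  · rw [← map_pow, h2, map_one]
  · rw [← map_mul, ← map_pow, h3, map_one]
  · rw [← map_mul, ← map_mul]; exact fun h => h4 (e.symm.injective h)
  · rw [← map_mul, ← map_pow, ← map_mul, ← map_mul]; exact fun h => h5 (e.symm.injective h)

set_option maxRecDepth 100000 in
theorem hedFact_A4 : HedFact (alternatingGroup (Fin 4)) := by
  refine ⟨inferInstance, ?_, ⟨Equiv.swap 0 1 * Equiv.swap 1 2, ?_⟩,
    ⟨Equiv.swap 0 1 * Equiv.swap 0 3, ?_⟩, ?_, ?_, ?_, ?_, ?_⟩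
  · rw [nat_card_alternatingGroup]; simp [Nat.factorial]
  · rw [Equiv.Perm.mem_alternatingGroup]; decide
  · rw [Equiv.Perm.mem_alternatingGroup]; decide
  · rw [Subtype.ext_iff]; decide
  · rw [Subtype.ext_iff]; decide
  · rw [Subtype.ext_iff]; decide
  · rw [Ne, Subtype.ext_iff]; decide
  · rw [Ne, Subtype.ext_iff]; decide

set_option maxRecDepth 100000 in
theorem hedFact_A5 : HedFact (alternatingGroup (Fin 5)) := by
  refine ⟨inferInstance, ?_, ⟨Equiv.swap 0 1 * Equiv.swap 1 2, ?_⟩,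
    ⟨Equiv.swap 0 1 * Equiv.swap 0 3, ?_⟩, ?_, ?_, ?_, ?_, ?_⟩
  · rw [nat_card_alternatingGroup]; simp [Nat.factorial]
  · rw [Equiv.Perm.mem_alternatingGroup]; decide
  · rw [Equiv.Perm.mem_alternatingGroup]; decide
  · rw [Subtype.ext_iff]; decide
  · rw [Subtype.ext_iff]; decide
  · rw [Subtype.ext_iff]; decide
  · rw [Ne, Subtype.ext_iff]; decide
  · rw [Ne, Subtype.ext_iff]; decide

theorem hedFact_SL3 : HedFact (Matrix.SpecialLinearGroup (Fin 2) (ZMod 3)) := by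
  refine ⟨inferInstance, ?_, ⟨!![1, 1; 0, 1], by decide⟩, ⟨!![1, 0; -1, 1], by decide⟩, by decide,
    by decide, by decide, by decide, by decide⟩
  refine (Subgroup.card_dvd_of_injective Matrix.SpecialLinearGroup.toGL
    Matrix.SpecialLinearGroup.toGL_injective).trans ?_
  rw [Matrix.card_GL_field]; simp [Fin.prod_univ_two, ZMod.card]

theorem hedFact_SL5 : HedFact (Matrix.SpecialLinearGroup (Fin 2) (ZMod 5)) := by
  refine ⟨inferInstance, ?_, ⟨!![0, 1; -1, -1], by decide⟩, ⟨!![0, 2; 2, -1], by decide⟩, by decide,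
    by decide, by decide, by decide, by decide⟩
  have : Fact (Nat.Prime 5) := ⟨by norm_num⟩
  refine (Subgroup.card_dvd_of_injective Matrix.SpecialLinearGroup.toGL
    Matrix.SpecialLinearGroup.toGL_injective).trans ?_
  rw [Matrix.card_GL_field]; simp [Fin.prod_univ_two, ZMod.card]

/-- let `l > 5` be prime and `k` an algebraic extension of `𝔽_l`
containing a primitive cube root of unity.  Let `G` be a group isomorphic to `A₄`, `A₅`,
`SL₂(𝔽₃)` (the binary tetrahedral group) or `SL₂(𝔽₅)` (the binary icosahedral group), and
`r : G → GL₂(k)` a faithful representation for which `k²` is irreducible.  Then `r(G)` is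
2-big. -/
theorem isTwoBig_image_of_faithful_irreducible_hedral (l : ℕ) [Fact l.Prime] (hl : 5 < l)
    (k : Type*) [Field k] [Algebra (ZMod l) k] [Algebra.IsAlgebraic (ZMod l) k]
    (ζ : k) (hζ : IsPrimitiveRoot ζ 3)
    (G : Type*) [Group G]
    (hG :
      Nonempty (G ≃* alternatingGroup (Fin 4)) ∨
      Nonempty (G ≃* alternatingGroup (Fin 5)) ∨
      Nonempty (G ≃* Matrix.SpecialLinearGroup (Fin 2) (ZMod 3)) ∨
      Nonempty (G ≃* Matrix.SpecialLinearGroup (Fin 2) (ZMod 5)))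
    (r : G →* GL (Fin 2) k) (hinj : Function.Injective r)
    (hirr : ∀ U : Submodule k (Fin 2 → k),
      (∀ v ∈ U, ∀ g : G, (r g).val.mulVec v ∈ U) → U = ⊥ ∨ U = ⊤) :
    IsMBig l 2 r.range := by
  have hp : l.Prime := Fact.out
  have hfact : HedFact G := by
    rcases hG with ⟨⟨e⟩⟩ | ⟨⟨e⟩⟩ | ⟨⟨e⟩⟩ | ⟨⟨e⟩⟩
    · exact hedFact_A4.of_equiv e
    · exact hedFact_A5.of_equiv e
    · exact hedFact_SL3.of_equiv e
    · exact hedFact_SL5.of_equiv e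
  obtain ⟨hfin, hcard, a, b, ha, hb, hab, hne, hne2⟩ := hfact
  haveI : CharP k l := charP_of_injective_algebraMap (algebraMap (ZMod l) k).injective l
  have hcast : ∀ n : ℕ, n ∣ 480 → (n : k) ≠ 0 := fun n hn h =>
    hed_dvd hp hl hn ((CharP.cast_eq_zero_iff k l n).mp h)
  have h6 : ((6 : ℕ) : k) ≠ 0 := hcast 6 (by norm_num)
  have h2 : (2 : k) ≠ 0 := by exact_mod_cast hcast 2 (by norm_num)
  have hrange : Nat.card r.range = Nat.card G :=
    (Nat.card_congr (MonoidHom.ofInjective hinj).toEquiv).symm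
  haveI : Finite r.range := Finite.of_equiv _ (MonoidHom.ofInjective hinj).toEquiv
  have hcH : Nat.card r.range ∣ 480 := by rw [hrange]; exact hcard
  have hdet : ((r a).val * (r b).val - (r b).val * (r a).val).det ≠ 0 := by
    intro hd
    apply hne
    apply hinj
    rw [map_mul, map_mul]
    refine hed_comm (r a) (r b) (Nat.card G) (hcast _ hcard) ?_ hd
    rw [← map_inv, ← map_inv, ← map_mul, ← map_mul, ← map_mul, ← map_pow, pow_card_eq_one',
      map_one]
  have hcancel : ∀ X : Matrix (Fin 2) (Fin 2) k,
      X * ((r a).val * (r b).val - (r b).val * (r a).val) = 0 → X = 0 := by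
    intro X hX
    have hu : IsUnit ((r a).val * (r b).val - (r b).val * (r a).val) :=
      (Matrix.isUnit_iff_isUnit_det _).mpr (isUnit_iff_ne_zero.mpr hdet)
    exact (hu.mul_left_eq_zero).mp hX
  have hns : ∀ h x : G, h ^ 2 * x ≠ x * h ^ 2 → ∀ s : k, (r h).val ^ 2 ≠ s • 1 := by
    intro h x hx s hs
    apply hx
    apply hinj
    apply Units.ext
    simp only [map_mul, map_pow, Units.val_mul, Units.val_pow_eq_pow_val, hs]
    simp
  have h3ne : ∀ h x : G, h ^ 3 = 1 → h * x ≠ x * h → h ^ 2 * x ≠ x * h ^ 2 := by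
    intro h x h3 hx hx2
    apply hx
    have e : h = h ^ 2 * h ^ 2 := by
      rw [← pow_add, show 2 + 2 = 3 + 1 from rfl, pow_add, h3, one_mul, pow_one]
    have hc : Commute (h ^ 2) x := hx2
    have := hc.mul_left hc
    rw [← e] at this
    exact this
  have hpow : ∀ h : G, h ^ 6 = 1 → (r h).val ^ 6 = 1 := by
    intro h hh
    rw [← Units.val_pow_eq_pow_val, ← map_pow, hh, map_one, Units.val_one]
  have h36 : ∀ h : G, h ^ 3 = 1 → h ^ 6 = 1 := by
    intro h hh
    rw [show 6 = 3 * 2 from rfl, pow_mul, hh, one_pow]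
  refine ⟨?_, ?_, ?_, ?_⟩
  · intro N _ j hj
    have h1 : Nat.card (r.range ⧸ N) ∣ 480 := (Subgroup.card_quotient_dvd_card N).trans hcH
    exact hed_dvd hp hl h1 (by rw [hj]; exact dvd_pow_self _ (by omega))
  · intro X hX hcomm
    exact hcancel X (hed_XN h2 _ _ X hX (hcomm ⟨r a, a, rfl⟩) (hcomm ⟨r b, b, rfl⟩))
  · intro c hc0 hc
    haveI := Fintype.ofFinite r.range
    set n : k := (Nat.card r.range : k) with hn
    have hn0 : n ≠ 0 := hcast _ hcH
    set S := ∑ h : r.range, c h with hS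
    have hsum : ∀ g : r.range, S = n • c g +
        (g : GL (Fin 2) k).val * S * ((g : GL (Fin 2) k)⁻¹).val := by
      intro g
      have e1 : S = ∑ h : r.range, c (g * h) :=
        (Equiv.sum_comp (Equiv.mulLeft g) c).symm
      conv_lhs => rw [e1]
      simp only [hc]
      rw [Finset.sum_add_distrib, Finset.sum_const, Finset.card_univ, ← Nat.card_eq_fintype_card,
        ← Finset.sum_mul, ← Finset.mul_sum, hn, Nat.cast_smul_eq_nsmul, ← hS]
    refine ⟨-(n⁻¹ • S), ?_, ?_⟩
    · rw [trace_neg, trace_smul, hS, trace_sum]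
      simp [hc0]
    · intro g
      have e := hsum g
      have e2 : n • c g = S - (g : GL (Fin 2) k).val * S * ((g : GL (Fin 2) k)⁻¹).val := by
        rw [eq_sub_iff_add_eq]; exact e.symm
      rw [mul_neg, neg_mul, mul_smul_comm, smul_mul_assoc, sub_neg_eq_add, neg_add_eq_sub,
        ← smul_sub, ← e2, smul_smul, inv_mul_cancel₀ hn0, one_smul]
  · intro W hW hW0 _
    by_contra hcon
    push Not at hcon
    apply hW0
    rw [Submodule.eq_bot_iff]
    intro w hw
    have good : ∀ h x : G, h ^ 6 = 1 → h ^ 2 * x ≠ x * h ^ 2 →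
        w.trace = 0 ∧ (w * (r h).val).trace = 0 := by
      intro h x hh hx
      refine hed_good h6 ζ hζ (r h).val (hpow h hh) (hns h x hx) w ?_
      intro α h1 h2
      exact hcon ⟨r h, h, rfl⟩ α h1 h2 w hw
    have ga := good a b (h36 a ha) (h3ne a b ha hne)
    have gb := good b a (h36 b hb) (h3ne b a hb hne.symm)
    have gab := good (a * b) a hab hne2
    rw [map_mul, Units.val_mul] at gab
    exact hcancel w (hed_wN h2 _ _ w ga.1 ga.2 gb.2 gab.2)
end

section
/- Let G be a finite group and l a prime with gcd(l, |G|) = 1, and let k be an algebraic extension of F_l. Let r : G → GL_2(k) be an injective group homomorphism such that k^2 is irreducible as a k[G]-module via r. Suppose further that: (a) the representation ad^0 r of G on the trace-zero 2-by-2 matrices sl_2(k) (with g acting by conjugation by r(g)) is irreducible; and (b) there exists an odd prime p such that G has a non-central element of order p and k contains a primitive p-th root of unity. Then r(G) is a 2-big subgroup of GL_2(k). -/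
open Matrix Polynomial

lemma aux_span {k : Type*} [Field k] (X : Matrix (Fin 2) (Fin 2) k) :
    Submodule.span k {X} ≠ LinearMap.ker (Matrix.traceLinearMap (Fin 2) k k) := by
  intro h
  have h1 : (!![0, 1; 0, 0] : Matrix (Fin 2) (Fin 2) k) ∈ Submodule.span k {X} := by
    rw [h]; simp [Matrix.trace_fin_two]
  have h2 : (!![0, 0; 1, 0] : Matrix (Fin 2) (Fin 2) k) ∈ Submodule.span k {X} := by
    rw [h]; simp [Matrix.trace_fin_two]
  obtain ⟨a, ha⟩ := Submodule.mem_span_singleton.1 h1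
  obtain ⟨b, hb⟩ := Submodule.mem_span_singleton.1 h2
  have e1 := congrFun (congrFun ha 0) 1
  have e2 := congrFun (congrFun hb 0) 1
  have e3 := congrFun (congrFun hb 1) 0
  have e4 := congrFun (congrFun ha 1) 0
  simp at e1 e2 e3 e4
  grind

lemma aux_comm {k : Type*} [Field k] {G : Type*} [Group G] (r : G →* GL (Fin 2) k)
    (had0 : ∀ U : Submodule k (Matrix (Fin 2) (Fin 2) k),
      U ≤ LinearMap.ker (Matrix.traceLinearMap (Fin 2) k k) →
      (∀ X ∈ U, ∀ g : G, (r g).val * X * ((r g)⁻¹).val ∈ U) →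
      U = ⊥ ∨ U = LinearMap.ker (Matrix.traceLinearMap (Fin 2) k k))
    (X : Matrix (Fin 2) (Fin 2) k) (htr : X.trace = 0)
    (hX : ∀ g : G, (r g).val * X = X * (r g).val) : X = 0 := by
  have h1 : Submodule.span k {X} ≤ LinearMap.ker (Matrix.traceLinearMap (Fin 2) k k) := by
    rw [Submodule.span_singleton_le_iff_mem]; simpa using htr
  have h2 : ∀ Y ∈ Submodule.span k {X}, ∀ g : G,
      (r g).val * Y * ((r g)⁻¹).val ∈ Submodule.span k {X} := by
    intro Y hY g
    obtain ⟨a, rfl⟩ := Submodule.mem_span_singleton.1 hY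
    have : (r g).val * (a • X) * ((r g)⁻¹).val = a • X := by
      rw [Matrix.mul_smul, hX, Matrix.smul_mul, Matrix.mul_assoc, Units.mul_inv, Matrix.mul_one]
    rw [this]; exact hY
  rcases had0 _ h1 h2 with h | h
  · simpa using h
  · exact absurd h (aux_span X)

lemma aux_two {k : Type*} [Field k] {G : Type*} [Group G] (r : G →* GL (Fin 2) k)
    (had0 : ∀ U : Submodule k (Matrix (Fin 2) (Fin 2) k),
      U ≤ LinearMap.ker (Matrix.traceLinearMap (Fin 2) k k) →
      (∀ X ∈ U, ∀ g : G, (r g).val * X * ((r g)⁻¹).val ∈ U) →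
      U = ⊥ ∨ U = LinearMap.ker (Matrix.traceLinearMap (Fin 2) k k)) : (2 : k) ≠ 0 := by
  intro h
  have := aux_comm r had0 1 (by simp [Matrix.trace_fin_two, one_add_one_eq_two, h]) (by simp)
  exact one_ne_zero this

/-- Cayley-Hamilton for a 2 by 2 matrix with a known root. -/
lemma aux_ch {k : Type*} [Field k] (A : Matrix (Fin 2) (Fin 2) k) (α : k)
    (hα : (A - α • (1 : Matrix (Fin 2) (Fin 2) k)).det = 0) :
    (A - α • (1 : Matrix (Fin 2) (Fin 2) k)) * (A - (A.trace - α) • 1) = 0 := by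
  rw [Matrix.det_fin_two] at hα
  simp at hα
  ext i j
  fin_cases i <;> fin_cases j <;> simp [Matrix.mul_apply, Matrix.trace_fin_two] <;> grind

lemma aux_charpoly {k : Type*} [Field k] (A : Matrix (Fin 2) (Fin 2) k) (α : k)
    (hα : (A - α • (1 : Matrix (Fin 2) (Fin 2) k)).det = 0) :
    A.charpoly = (X - C α) * (X - C (A.trace - α)) := by
  have h : A.det = α * (A.trace - α) := by
    rw [Matrix.det_fin_two] at hα ⊢
    simp [Matrix.trace_fin_two] at hα ⊢
    grind
  rw [Matrix.charpoly_fin_two, h]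
  simp only [map_mul, map_sub]
  ring

lemma aux_eig {k : Type*} [Field k] (A : Matrix (Fin 2) (Fin 2) k) (p : ℕ) (hp : p.Prime)
    (hodd : Odd p) (ζ : k) (hζ : IsPrimitiveRoot ζ p) (hA : A ^ p = 1)
    (hs : ∀ a : k, A ≠ a • 1) :
    ∃ α : k, (A - α • (1 : Matrix (Fin 2) (Fin 2) k)).det = 0 ∧ α ≠ A.trace - α ∧
      α ^ 2 ≠ (A.trace - α) ^ 2 := by
  have hp0 : (p : k) ≠ 0 := by
    have : NeZero p := ⟨hp.ne_zero⟩
    exact (hζ.neZero').out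
  have hex : ∃ α : k, α ^ p = 1 ∧ (A - α • (1 : Matrix (Fin 2) (Fin 2) k)).det = 0 := by
    have h1 := X_pow_sub_one_eq_prod hp.pos hζ
    let f : k[X] →* k := Matrix.detMonoidHom.comp (aeval A : k[X] →ₐ[k] _).toRingHom.toMonoidHom
    have hf : ∀ q, f q = (aeval A q).det := fun q => rfl
    have h2 : f (X ^ p - 1) = 0 := by
      rw [hf]; simp [hA]
    rw [h1, map_prod, Finset.prod_eq_zero_iff] at h2
    obtain ⟨a, ha, h3⟩ := h2
    refine ⟨a, (mem_nthRootsFinset hp.pos _).1 ha, ?_⟩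
    rw [hf] at h3
    simpa [Algebra.algebraMap_eq_smul_one] using h3
  obtain ⟨α, hαp, hα⟩ := hex
  have hch := aux_ch A α hα
  set β := A.trace - α with hβ
  have hne : α ≠ β := by
    intro hab
    rw [← hab] at hch
    set N := A - α • (1 : Matrix (Fin 2) (Fin 2) k) with hN
    have hAN : A = α • 1 + N := by simp [hN]
    have key : ∀ n : ℕ, α • A ^ n = (α ^ (n+1)) • 1 + (n * α ^ n) • N := by
      intro n
      induction n with
      | zero => simp
      | succ n ih =>
        rw [pow_succ, ← smul_mul_assoc, ih]
        conv_lhs => rw [hAN]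
        simp only [add_mul, mul_add, smul_mul_assoc, mul_smul_comm, hch, one_mul, mul_one]
        push_cast
        module
    have h := key p
    rw [hA, pow_succ, hαp] at h
    simp at h
    rcases h with h | h
    · exact hp0 h
    · exact hs α (by rw [hAN, h, add_zero])
  refine ⟨α, hα, hne, ?_⟩
  intro hsq
  have hdet : A.det = α * β := by
    rw [Matrix.det_fin_two] at hα ⊢
    simp [Matrix.trace_fin_two, hβ] at hα ⊢
    grind
  have hβp : β ^ p = 1 := by
    have := congrArg Matrix.det hA
    rw [Matrix.det_pow, hdet, mul_pow, hαp] at this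
    simpa using this
  obtain ⟨m, rfl⟩ := hodd
  rw [pow_succ, pow_mul] at hαp hβp
  rw [hsq] at hαp
  have : (β^2)^m ≠ 0 := by rintro h; simp [h] at hβp
  exact hne (mul_left_cancel₀ this (hαp.trans hβp.symm))

/-- let `G` be a finite group of order prime to `l`, `k` an algebraic
extension of `𝔽_l`, and `r : G → GL₂(k)` a faithful representation with `k²` irreducible.
If `ad⁰ r` (conjugation on trace-zero matrices) is irreducible, and there is an odd prime
`p` such that `G` has a non-central element of order `p` and `k` has a primitive `p`-th
root of unity, then `r(G)` is 2-big. -/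
theorem isTwoBig_image_of_ad0_irreducible (l : ℕ) [Fact l.Prime]
    (k : Type*) [Field k] [Algebra (ZMod l) k] [Algebra.IsAlgebraic (ZMod l) k]
    (G : Type*) [Group G] [Finite G] (hcop : Nat.Coprime l (Nat.card G))
    (r : G →* GL (Fin 2) k) (hinj : Function.Injective r)
    (hirr : ∀ U : Submodule k (Fin 2 → k),
      (∀ v ∈ U, ∀ g : G, (r g).val.mulVec v ∈ U) → U = ⊥ ∨ U = ⊤)
    (had0 : ∀ U : Submodule k (Matrix (Fin 2) (Fin 2) k),
      U ≤ LinearMap.ker (Matrix.traceLinearMap (Fin 2) k k) →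
      (∀ X ∈ U, ∀ g : G, (r g).val * X * ((r g)⁻¹).val ∈ U) →
      U = ⊥ ∨ U = LinearMap.ker (Matrix.traceLinearMap (Fin 2) k k))
    (p : ℕ) (hp : p.Prime) (hodd : Odd p)
    (g₀ : G) (hg₀ : g₀ ∉ Subgroup.center G) (horder : orderOf g₀ = p)
    (ζ : k) (hζ : IsPrimitiveRoot ζ p) :
    IsMBig l 2 r.range := by
  have h2 := aux_two r had0
  have hinv : ∀ (h : r.range), ∃ g, r g = h := fun h => h.2
  have hcard : Nat.card r.range = Nat.card G :=
    (Nat.card_congr (MonoidHom.ofInjective hinj).toEquiv).symm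
  have : Finite r.range := Finite.of_surjective _ r.rangeRestrict_surjective
  have hcomm : ∀ X : Matrix (Fin 2) (Fin 2) k, X.trace = 0 →
    (∀ h : r.range, (h : GL (Fin 2) k).val * X = X * (h : GL (Fin 2) k).val) → X = 0 :=
    fun X ht hX => aux_comm r had0 X ht (fun g => hX ⟨r g, g, rfl⟩)
  refine ⟨?_, hcomm, ?_, ?_⟩
  · intro N _ j hj
    have h1 : Nat.card (r.range ⧸ N) ∣ Nat.card G := hcard ▸ N.card_quotient_dvd_card
    rw [hj] at h1
    have h3 : l ∣ Nat.card G := (dvd_pow_self l (Nat.succ_ne_zero j)).trans h1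
    have := Nat.Coprime.eq_one_of_dvd hcop h3
    exact (Fact.out : l.Prime).one_lt.ne' this
  · intro c hc0 hc
    classical
    have := Fintype.ofFinite r.range
    have : CharP k l := charP_of_injective_algebraMap (algebraMap (ZMod l) k).injective l
    have hn : (Nat.card r.range : k) ≠ 0 := by
      rw [Ne, CharP.cast_eq_zero_iff k l, hcard]
      intro h3
      exact (Fact.out : l.Prime).one_lt.ne' (Nat.Coprime.eq_one_of_dvd hcop h3)
    refine ⟨-((Nat.card r.range : k)⁻¹ • ∑ h, c h), ?_, ?_⟩
    · simp [Matrix.trace_sum, hc0]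
    · intro g
      have hsum : ∑ h, c h = (Nat.card r.range : k) • c g +
          (g : GL (Fin 2) k).val * (∑ h, c h) * ((g : GL (Fin 2) k)⁻¹).val := by
        conv_lhs => rw [← Equiv.sum_comp (Equiv.mulLeft g) c]
        simp only [Equiv.coe_mulLeft, hc]
        rw [Finset.sum_add_distrib, Finset.sum_const, Finset.card_univ, Matrix.mul_sum,
          Matrix.sum_mul, Nat.card_eq_fintype_card, Nat.cast_smul_eq_nsmul]
      generalize hS : ∑ h, c h = S at hsum ⊢
      have : (g : GL (Fin 2) k).val * S * ((g : GL (Fin 2) k)⁻¹).val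
          = S - (Nat.card r.range : k) • c g := by
        rw [eq_sub_iff_add_eq, add_comm]; exact hsum.symm
      rw [Matrix.mul_neg, Matrix.neg_mul, Matrix.mul_smul, Matrix.smul_mul, this, smul_sub,
        smul_smul, inv_mul_cancel₀ hn]
      module
  · intro W hW hW0 _
    set A := (r g₀).val with hA
    have hAp : A ^ p = 1 := by
      rw [hA, ← Units.val_pow_eq_pow_val, ← map_pow, ← horder, pow_orderOf_eq_one]; simp
    have hs : ∀ a : k, A ≠ a • 1 := by
      intro a ha
      apply hg₀
      rw [Subgroup.mem_center_iff]
      intro g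
      apply hinj
      apply Units.ext
      simp only [map_mul, Units.val_mul]
      rw [← hA, ha]; simp
    obtain ⟨α, hα, hne, hsq⟩ := aux_eig A p hp hodd ζ hζ hAp hs
    have hch := aux_ch A α hα
    have hcp := aux_charpoly A α hα
    generalize hβ : A.trace - α = β at *
    have hd : α - β ≠ 0 := sub_ne_zero.2 hne
    have hP : eigProj A α = (α - β)⁻¹ • (A - β • 1) := by rw [eigProj, hβ]
    have hP0 : eigProj A α ≠ 0 := by
      rw [hP]
      simp only [ne_eq, smul_eq_zero, inv_eq_zero, hd, false_or, sub_eq_zero]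
      exact hs β
    have hAP : A * eigProj A α = α • eigProj A α := by
      rw [hP, Matrix.mul_smul, smul_comm]
      congr 1
      rwa [Matrix.sub_mul, Matrix.smul_mul, Matrix.one_mul, sub_eq_zero] at hch
    have hPP : eigProj A α * eigProj A α = eigProj A α := by
      nth_rewrite 1 [hP]
      rw [Matrix.smul_mul, Matrix.sub_mul, hAP, Matrix.smul_mul, Matrix.one_mul, ← sub_smul,
        smul_smul, inv_mul_cancel₀ hd, one_smul]
    refine ⟨⟨r g₀, g₀, rfl⟩, α, ?_, ?_, ?_⟩
    · classical
      change A.charpoly.rootMultiplicity α = 1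
      rw [hcp, rootMultiplicity_mul (mul_ne_zero (X_sub_C_ne_zero _) (X_sub_C_ne_zero _)),
        rootMultiplicity_X_sub_C_self, rootMultiplicity_X_sub_C, if_neg hne]
    · change ∀ b : k, A.charpoly.IsRoot b → _
      intro b hb hbα
      rw [hcp, root_mul, root_X_sub_C, root_X_sub_C] at hb
      rcases hb with hb | hb
      · exact absurd hb.symm hbα
      · rwa [← hb]
    · change ∃ w ∈ W, eigProj A α * w * eigProj A α ≠ 0
      have hinv2 : ∀ Y ∈ W ⊓ LinearMap.ker (Matrix.traceLinearMap (Fin 2) k k), ∀ g : G,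
          (r g).val * Y * ((r g)⁻¹).val ∈ W ⊓ LinearMap.ker (Matrix.traceLinearMap (Fin 2) k k) := by
        rintro Y ⟨hY1, hY2⟩ g
        refine ⟨hW Y hY1 ⟨r g, g, rfl⟩, ?_⟩
        have hY3 : Y.trace = 0 := hY2
        change _ ∈ LinearMap.ker _
        rw [LinearMap.mem_ker, Matrix.traceLinearMap_apply,
              Matrix.trace_mul_cycle, Units.inv_mul, Matrix.one_mul, hY3]
      rcases had0 (W ⊓ LinearMap.ker (Matrix.traceLinearMap (Fin 2) k k)) inf_le_right hinv2 with h | h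
      · obtain ⟨w, hw, hw0⟩ := Submodule.exists_mem_ne_zero_of_ne_bot hW0
        have hc : ∀ h : r.range, (h : GL (Fin 2) k).val * w = w * (h : GL (Fin 2) k).val := by
          intro h'
          have : (h' : GL (Fin 2) k).val * w * ((h' : GL (Fin 2) k)⁻¹).val - w ∈
              W ⊓ LinearMap.ker (Matrix.traceLinearMap (Fin 2) k k) := by
            refine ⟨W.sub_mem (hW w hw h') hw, ?_⟩
            change _ ∈ LinearMap.ker _
            rw [LinearMap.mem_ker, Matrix.traceLinearMap_apply, Matrix.trace_sub,
              Matrix.trace_mul_cycle, Units.inv_mul, Matrix.one_mul, sub_self]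
          rw [h, Submodule.mem_bot, sub_eq_zero] at this
          conv_rhs => rw [← this]
          rw [Matrix.mul_assoc _ _ (h' : GL (Fin 2) k).val, Units.inv_mul, Matrix.mul_one]
        have hz := hcomm (w - (w.trace / 2) • 1) (by
          simp [Matrix.trace_sub, Matrix.trace_smul]
          field_simp; ring) (by
          intro h'
          rw [Matrix.mul_sub, Matrix.sub_mul, hc h']; simp)
        rw [sub_eq_zero] at hz
        refine ⟨w, hw, ?_⟩
        have ht : w.trace / 2 ≠ 0 := by
          intro h0; rw [h0, zero_smul] at hz; exact hw0 hz
        rw [hz, Matrix.mul_smul, Matrix.mul_one, Matrix.smul_mul, hPP]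
        exact smul_ne_zero ht hP0
      · refine ⟨A - ((α + β) / 2) • 1, ?_, ?_⟩
        · have : A - ((α + β) / 2) • 1 ∈ LinearMap.ker (Matrix.traceLinearMap (Fin 2) k k) := by
            rw [LinearMap.mem_ker, Matrix.traceLinearMap_apply, ← hβ]
            simp [Matrix.trace_sub, Matrix.trace_smul]
            field_simp; ring
          rw [← h] at this
          exact this.1
        · rw [Matrix.mul_assoc, Matrix.sub_mul, hAP, Matrix.smul_mul, Matrix.one_mul, ← sub_smul,
            Matrix.mul_smul, hPP]
          refine smul_ne_zero ?_ hP0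
          intro h0
          apply hd
          field_simp at h0
          linear_combination h0
end
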